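/- Fix an integer p ≥ 2, let K_p be the complete simple graph on p vertices with edge set E (so |E| = p(p−1)/2), and let T_{K_p}(x) = Σ_{T ∈ 𝒯(K_p)} Π_{e ∈ T} x_e be its spanning-tree polynomial. If β ∉ {0, 1/2, 1, 3/2, …} ∪ [(p−2)/2, ∞), then T_{K_p}^{-β} is not completely monotone on any nonempty open convex subcone of (0,∞)^E. -/

import Mathlib

/-- The open positive orthant `(0,∞)^ι`. -/
def posOrthant (ι : Type*) : Set (ι → ℝ) := {x | ∀ i, 0 < x i}

/-- Complete monotonicity on an (open convex cone) subset `C` of a real normed space: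
`f` is `C^∞` on `C` and `(−1)^k D_{u_1}···D_{u_k} f(x) ≥ 0` for all `k ≥ 0`, all
directions `u_1, …, u_k ∈ C` and all `x ∈ C`. -/
def CompletelyMonotoneOn {E : Type*} [NormedAddCommGroup E] [NormedSpace ℝ E]
    (f : E → ℝ) (C : Set E) : Prop :=
  ContDiffOn ℝ (⊤ : ℕ∞) f C ∧
    ∀ (k : ℕ) (u : Fin k → E), (∀ i, u i ∈ C) → ∀ x ∈ C,
      0 ≤ (-1 : ℝ) ^ k * iteratedFDerivWithin ℝ k f C x u

/-- A set `t` of edges of `G` is (the edge set of) a spanning tree if the spanning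
subgraph with edge set `t` is connected and acyclic. -/
def IsSpanningTree {V : Type*} (G : SimpleGraph V) (t : Set G.edgeSet) : Prop :=
  (SimpleGraph.fromEdgeSet (Subtype.val '' t)).Connected ∧
    (SimpleGraph.fromEdgeSet (Subtype.val '' t)).IsAcyclic

open scoped Classical in
/-- The spanning-tree polynomial `T_G(x) = Σ_{T ∈ 𝒯(G)} Π_{e ∈ T} x_e` of `G`. -/
noncomputable def spanningTreePoly {V : Type*} (G : SimpleGraph V)
    [Fintype G.edgeSet] (x : G.edgeSet → ℝ) : ℝ :=
  ∑ t ∈ Finset.univ.filter (fun t : Finset G.edgeSet => IsSpanningTree G ↑t),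
    ∏ e ∈ t, x e

section

open scoped ContDiff

open MvPolynomial in
/-- The symmetrised partial derivative `½(∂/∂y_{ik} + ∂/∂y_{ki})` on polynomials in the entries
of a square matrix of variables. -/
noncomputable def symmPDeriv {ι : Type*} (i k : ι) :
    Derivation ℝ (MvPolynomial (ι × ι) ℝ) (MvPolynomial (ι × ι) ℝ) :=
  (1 / 2 : ℝ) • (pderiv (i, k) + pderiv (k, i))

open MvPolynomial in
/-- A linear functional on polynomials in the entries `y_{ij}` of a matrix of variables satisfies
the Stein identity with parameter `s` if
`L(y_{ij} q) = s δ_{ij} L(q) - ∑ₖ L(y_{kj} D_{ik} q)`. It characterises the Taylor coefficients at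
`0` of `Z ↦ det(1 + (Z + Zᵀ)/2)^s`. -/
def SteinIdentity {ι : Type*} [Fintype ι] [DecidableEq ι] (s : ℝ)
    (L : MvPolynomial (ι × ι) ℝ →ₗ[ℝ] ℝ) : Prop :=
  ∀ (i j : ι) (q : MvPolynomial (ι × ι) ℝ),
    L (X (i, j) * q) =
      s * (if i = j then 1 else 0) * L q - ∑ k, L (X (k, j) * symmPDeriv i k q)

theorem Derivation.map_prod_eq_zero {R A M α : Type*} [CommRing R] [CommRing A] [Algebra R A]
    [AddCommGroup M] [Module A M] [Module R M] (D : Derivation R A M) (t : Finset α)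
    (f : α → A) (h : ∀ a ∈ t, D (f a) = 0) : D (∏ a ∈ t, f a) = 0 := by
  classical
  induction t using Finset.induction_on with
  | empty => simp
  | insert a t ha ih =>
    rw [Finset.prod_insert ha, D.leibniz, h a (by simp), ih fun b hb => h b (by simp [hb])]
    simp

theorem Derivation.map_det_eq_zero {R A n : Type*} [CommRing R] [CommRing A] [Algebra R A]
    [Fintype n] [DecidableEq n] (D : Derivation R A A) (M : Matrix n n A)
    (h : ∀ i j, D (M i j) = 0) : D M.det = 0 := by
  rw [Matrix.det_apply, map_sum]
  refine Finset.sum_eq_zero fun σ _ => ?_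
  rw [Units.smul_def, map_zsmul, D.map_prod_eq_zero _ _ fun a _ => h _ _, smul_zero]

namespace SteinIdentity

open MvPolynomial Matrix

/-- The generic matrix of variables. -/
local notation "𝐘" m => mvPolynomialX (Fin m) (Fin m) ℝ

theorem pderiv_row_adjugate {m : ℕ} (k j : Fin (m + 1)) :
    pderiv (0, k) ((𝐘 (m + 1)).adjugate j 0) = 0 := by
  rw [adjugate_fin_succ_eq_det_submatrix, Derivation.leibniz]
  rw [Derivation.map_det_eq_zero]
  · simp
  · intro a b
    simp only [submatrix_apply, mvPolynomialX_apply, pderiv_X]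
    rw [Pi.single_eq_of_ne]
    simp [Prod.ext_iff]

theorem pderiv_det {m : ℕ} :
    pderiv (0, 0) (𝐘 (m + 1)).det = (𝐘 (m + 1)).adjugate 0 0 := by
  have h : (𝐘 (m + 1)).det = ∑ j, X (0, j) * (𝐘 (m + 1)).adjugate j 0 := by
    have := congrFun₂ (mul_adjugate (𝐘 (m + 1))) 0 0
    simpa [mul_apply] using this.symm
  rw [h, map_sum, Finset.sum_eq_single 0]
  · rw [Derivation.leibniz, pderiv_row_adjugate]; simp
  · intro j _ hj
    rw [Derivation.leibniz, pderiv_row_adjugate, pderiv_X, Pi.single_eq_of_ne (by simp [hj])]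
    simp
  · simp

theorem sum_mul_pderiv_adjugate {m : ℕ} (k : Fin (m + 1)) (hk : k ≠ 0) :
    ∑ j, X (k, j) * pderiv (k, 0) ((𝐘 (m + 1)).adjugate j 0) =
      - (𝐘 (m + 1)).adjugate 0 0 := by
  have h : ∑ j, X (k, j) * (𝐘 (m + 1)).adjugate j 0 = 0 := by
    have := congrFun₂ (mul_adjugate (𝐘 (m + 1))) k 0
    simpa [mul_apply, hk] using this
  have h2 := congrArg (pderiv (R := ℝ) (k, (0 : Fin (m + 1)))) h
  simp only [map_sum, Derivation.leibniz, smul_eq_mul, map_zero, Finset.sum_add_distrib,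
    pderiv_X] at h2
  rw [Finset.sum_eq_single (f := fun x => (𝐘 (m + 1)).adjugate x 0 * _) 0
    (by intro j _ hj; rw [Pi.single_eq_of_ne (by simp [hj]), mul_zero]) (by simp)] at h2
  simpa using eq_neg_of_add_eq_zero_left h2

theorem sum_mul_symmPDeriv_adjugate {m : ℕ} (k : Fin (m + 1)) :
    ∑ j, X (k, j) * symmPDeriv 0 k ((𝐘 (m + 1)).adjugate j 0) =
      if k = 0 then 0 else (-1 / 2 : ℝ) • (𝐘 (m + 1)).adjugate 0 0 := by
  have h (j) : symmPDeriv 0 k ((𝐘 (m + 1)).adjugate j 0) =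
      (1 / 2 : ℝ) • pderiv (k, 0) ((𝐘 (m + 1)).adjugate j 0) := by
    simp [symmPDeriv, pderiv_row_adjugate]
  split_ifs with hk
  · subst hk
    simp [h, pderiv_row_adjugate]
  · simp_rw [h, mul_smul_comm, ← Finset.smul_sum, sum_mul_pderiv_adjugate k hk]
    module

/-- The dual form of the Cayley identity for symmetric matrices. -/
theorem map_det_mul {m : ℕ} {s : ℝ} {L : MvPolynomial (Fin (m + 1) × Fin (m + 1)) ℝ →ₗ[ℝ] ℝ}
    (hL : SteinIdentity s L) (r : MvPolynomial (Fin (m + 1) × Fin (m + 1)) ℝ) :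
    L ((𝐘 (m + 1)).det * r) =
      (s + m / 2) * L ((𝐘 (m + 1)).adjugate 0 0 * r) -
        L ((𝐘 (m + 1)).det * pderiv (0, 0) r) := by
  have h0 : (𝐘 (m + 1)).det = ∑ j, X (0, j) * (𝐘 (m + 1)).adjugate j 0 := by
    have := congrFun₂ (mul_adjugate (𝐘 (m + 1))) 0 0
    simpa [mul_apply] using this.symm
  have hk (k : Fin (m + 1)) : ∑ j, X (k, j) * (𝐘 (m + 1)).adjugate j 0 =
      if k = 0 then (𝐘 (m + 1)).det else 0 := by
    have := congrFun₂ (mul_adjugate (𝐘 (m + 1))) k 0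
    simpa [mul_apply, one_apply] using this
  have h1 : L ((𝐘 (m + 1)).det * r) =
      s * L ((𝐘 (m + 1)).adjugate 0 0 * r) - L (∑ k, ∑ j, X (k, j) *
        symmPDeriv 0 k ((𝐘 (m + 1)).adjugate j 0 * r)) := by
    conv_lhs => rw [h0, Finset.sum_mul, map_sum]
    rw [Finset.sum_congr rfl fun j _ => by rw [mul_assoc, hL], Finset.sum_sub_distrib]
    congr 1
    · simp
    · rw [Finset.sum_comm]; simp
  rw [h1]
  have h2 : ∑ k, ∑ j, X (k, j) * symmPDeriv 0 k ((𝐘 (m + 1)).adjugate j 0 * r) =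
      (𝐘 (m + 1)).det * pderiv (0, 0) r + (-(m : ℝ) / 2) • ((𝐘 (m + 1)).adjugate 0 0 * r) := by
    have e (k j : Fin (m + 1)) : X (k, j) * symmPDeriv 0 k ((𝐘 (m + 1)).adjugate j 0 * r) =
        (X (k, j) * (𝐘 (m + 1)).adjugate j 0) * symmPDeriv 0 k r +
        r * (X (k, j) * symmPDeriv 0 k ((𝐘 (m + 1)).adjugate j 0)) := by
      rw [Derivation.leibniz]; simp only [smul_eq_mul]; ring
    simp_rw [e, Finset.sum_add_distrib, ← Finset.sum_mul, ← Finset.mul_sum, hk,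
      sum_mul_symmPDeriv_adjugate]
    congr 1
    · simp only [ite_mul, zero_mul, Finset.sum_ite_eq', Finset.mem_univ, if_true, symmPDeriv]
      congr 1
      simp only [Derivation.smul_apply, Derivation.add_apply]
      module
    · rw [Fin.sum_univ_succ]
      simp only [if_true, Fin.succ_ne_zero, if_false, Finset.sum_const, Finset.card_univ,
        Fintype.card_fin, zero_add, mul_comm r, smul_mul_assoc, ← Nat.cast_smul_eq_nsmul ℝ,
        smul_smul]
      congr 1; ring
  rw [h2, map_add, map_smul, smul_eq_mul]
  ring

/-- Restriction to polynomials in a principal block. -/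
theorem comp_rename {ι κ : Type*} [Fintype ι] [DecidableEq ι] [Fintype κ] [DecidableEq κ] {s : ℝ}
    {L : MvPolynomial (ι × ι) ℝ →ₗ[ℝ] ℝ} (hL : SteinIdentity s L) (e : κ ↪ ι) :
    SteinIdentity s (L ∘ₗ (rename (Prod.map e e)).toLinearMap) := by
  intro i j q
  have hinj : Function.Injective (Prod.map e e) := e.injective.prodMap e.injective
  simp only [LinearMap.comp_apply, AlgHom.toLinearMap_apply, map_mul, rename_X, Prod.map_apply]
  rw [hL]
  congr 1
  · simp [e.injective.eq_iff]
  · rw [← Finset.sum_subset (Finset.subset_univ (Finset.univ.map e))]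
    · rw [Finset.sum_map]
      refine Finset.sum_congr rfl fun k _ => ?_
      congr 2
      simp only [symmPDeriv, Derivation.smul_apply, Derivation.add_apply, map_smul, map_add]
      rw [← pderiv_rename hinj, ← pderiv_rename hinj]
      rfl
    · intro k _ hk
      have hk' : k ∉ Set.range e := by simpa using hk
      have (a b : ι) (h : (a, b) ∉ Set.range (Prod.map e e)) :
          pderiv (a, b) (rename (Prod.map e e) q) = 0 := by
        apply pderiv_eq_zero_of_notMem_vars
        intro hv
        classical
        have := vars_rename (Prod.map e e) q hv
        simp only [Finset.mem_image] at this
        obtain ⟨x, -, hx⟩ := this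
        exact h ⟨x, hx⟩
      have hz : symmPDeriv (e i) k (rename (Prod.map e e) q) = 0 := by
        simp only [symmPDeriv, Derivation.smul_apply, Derivation.add_apply]
        rw [this, this]
        · simp
        · rintro ⟨⟨a, b⟩, h⟩; exact hk' ⟨a, congrArg Prod.fst h⟩
        · rintro ⟨⟨a, b⟩, h⟩; exact hk' ⟨b, congrArg Prod.snd h⟩
      rw [hz]; simp

theorem map_det_sq {m : ℕ} {s : ℝ} {L : MvPolynomial (Fin m × Fin m) ℝ →ₗ[ℝ] ℝ}
    (hL : SteinIdentity s L) :
    L ((𝐘 m).det ^ 2) =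
      (∏ k ∈ Finset.range m, ((s + k / 2) * (s - 1 + k / 2))) * L 1 := by
  induction m with
  | zero => simp
  | succ m ih =>
    have hadj : (𝐘 (m + 1)).adjugate 0 0 =
        rename (Prod.map (Fin.succEmb m) (Fin.succEmb m)) (𝐘 m).det := by
      rw [adjugate_fin_succ_eq_det_submatrix, AlgHom.map_det]
      simp only [Fin.val_zero, add_zero, pow_zero, one_mul]
      congr 1
      ext a b
      simp
    have hC : pderiv (0, 0) ((𝐘 (m + 1)).adjugate 0 0) = 0 := pderiv_row_adjugate 0 0
    have h1 := hL.map_det_mul (𝐘 (m + 1)).det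
    rw [pderiv_det, mul_comm _ (Matrix.adjugate _ 0 0)] at h1
    have h2 := hL.map_det_mul ((𝐘 (m + 1)).adjugate 0 0)
    rw [hC, mul_zero, map_zero, sub_zero, mul_comm _ (Matrix.adjugate _ 0 0)] at h2
    have h3 := ih (hL.comp_rename (Fin.succEmb m))
    simp only [LinearMap.comp_apply, AlgHom.toLinearMap_apply, map_pow, ← hadj, map_one] at h3
    rw [Finset.prod_range_succ, sq, h1, h2, ← sq, h3]
    ring

end SteinIdentity

/-- Functions that are smooth on `U` and vanish outside `U`. -/
def smoothSupportedOn {W : Type*} [NormedAddCommGroup W] [NormedSpace ℝ W] (U : Set W) :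
    Submodule ℝ (W → ℝ) where
  carrier := {F | ContDiffOn ℝ ∞ F U ∧ ∀ x ∉ U, F x = 0}
  add_mem' := fun hF hG => ⟨hF.1.add hG.1, fun x hx => by simp [hF.2 x hx, hG.2 x hx]⟩
  zero_mem' := ⟨contDiffOn_const, fun _ _ => rfl⟩
  smul_mem' := fun c _ hF => ⟨hF.1.const_smul c, fun x hx => by simp [hF.2 x hx]⟩

namespace smoothSupportedOn

variable {W : Type*} [NormedAddCommGroup W] [NormedSpace ℝ W] {U : Set W}

theorem indicator_mem {F : W → ℝ} (hF : ContDiffOn ℝ ∞ F U) :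
    U.indicator F ∈ smoothSupportedOn U :=
  ⟨hF.congr fun _ hx => Set.indicator_of_mem hx F, fun _ hx => Set.indicator_of_notMem hx F⟩

theorem differentiableAt (hU : IsOpen U) (F : smoothSupportedOn U) {x : W} (hx : x ∈ U) :
    DifferentiableAt ℝ F.1 x :=
  (F.2.1.contDiffAt (hU.mem_nhds hx)).differentiableAt (by simp)

theorem contDiffOn_fderiv_apply (hU : IsOpen U) {F : W → ℝ} (hF : ContDiffOn ℝ ∞ F U) (v : W) :
    ContDiffOn ℝ ∞ (fun x => fderiv ℝ F x v) U :=
  (hF.fderiv_of_isOpen hU (by simp)).clm_apply contDiffOn_const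

/-- The directional derivative as an operator on `smoothSupportedOn U`. -/
noncomputable def dirDeriv (hU : IsOpen U) (v : W) : Module.End ℝ (smoothSupportedOn U) where
  toFun F := ⟨U.indicator fun x => fderiv ℝ F.1 x v,
    indicator_mem (contDiffOn_fderiv_apply hU F.2.1 v)⟩
  map_add' F G := by
    ext x
    by_cases hx : x ∈ U
    · simp [hx, fderiv_add (differentiableAt hU F hx) (differentiableAt hU G hx)]
    · simp [hx]
  map_smul' c F := by
    ext x
    by_cases hx : x ∈ U
    · simp [hx, fderiv_const_smul (differentiableAt hU F hx)]
    · simp [hx]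

theorem dirDeriv_apply (hU : IsOpen U) (v : W) (F : smoothSupportedOn U) {x : W} (hx : x ∈ U) :
    (dirDeriv hU v F).1 x = fderiv ℝ F.1 x v := by
  simp [dirDeriv, hx]

theorem fderiv_dirDeriv (hU : IsOpen U) (v : W) (F : smoothSupportedOn U) {x : W} (hx : x ∈ U) :
    fderiv ℝ (dirDeriv hU v F).1 x = fderiv ℝ (fun y => fderiv ℝ F.1 y v) x := by
  apply Filter.EventuallyEq.fderiv_eq
  filter_upwards [hU.mem_nhds hx] with y hy
  exact dirDeriv_apply hU v F hy

theorem dirDeriv_comm (hU : IsOpen U) (v w : W) :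
    dirDeriv hU v * dirDeriv hU w = dirDeriv hU w * dirDeriv hU v := by
  ext F x
  by_cases hx : x ∈ U
  · simp only [Module.End.mul_apply]
    rw [dirDeriv_apply hU _ _ hx, dirDeriv_apply hU _ _ hx, fderiv_dirDeriv hU _ _ hx,
      fderiv_dirDeriv hU _ _ hx]
    have hc : ContDiffAt ℝ ∞ F.1 x := F.2.1.contDiffAt (hU.mem_nhds hx)
    have hd : DifferentiableAt ℝ (fderiv ℝ F.1) x :=
      (hc.fderiv_right (m := ∞) (by simp)).differentiableAt (by simp)
    rw [fderiv_clm_apply hd (differentiableAt_const _),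
      fderiv_clm_apply hd (differentiableAt_const _)]
    have := (hc.isSymmSndFDerivAt (by simpa using ENat.LEInfty.out)).eq v w
    simpa using this
  · simp [dirDeriv, hx]

/-- Multiplication by a continuous linear form as an operator on `smoothSupportedOn U`. -/
def mulLinear (ℓ : W →L[ℝ] ℝ) : Module.End ℝ (smoothSupportedOn U) where
  toFun F := ⟨fun x => ℓ x * F.1 x, ℓ.contDiff.contDiffOn.mul F.2.1,
    fun x hx => by simp [F.2.2 x hx]⟩
  map_add' F G := by ext x; simp [mul_add]
  map_smul' c F := by ext x; simp [mul_left_comm]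

theorem dirDeriv_mul_mulLinear (hU : IsOpen U) (v : W) (ℓ : W →L[ℝ] ℝ) :
    dirDeriv hU v * mulLinear ℓ = mulLinear ℓ * dirDeriv hU v + ℓ v • 1 := by
  ext F x
  by_cases hx : x ∈ U
  · have h1 : fderiv ℝ (mulLinear ℓ F).1 x =
        ℓ x • fderiv ℝ F.1 x + F.1 x • fderiv ℝ ℓ x :=
      fderiv_fun_mul ℓ.differentiableAt (differentiableAt hU F hx)
    simp only [Module.End.mul_apply, LinearMap.add_apply, LinearMap.smul_apply, Module.End.one_apply,
      Submodule.coe_add, Submodule.coe_smul, Pi.add_apply, Pi.smul_apply]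
    rw [dirDeriv_apply hU _ _ hx, h1]
    simp [mulLinear, dirDeriv_apply hU _ _ hx, mul_comm]
  · simp [dirDeriv, mulLinear, hx, F.2.2 x hx]

end smoothSupportedOn

open scoped IsMulCommutative in
open MvPolynomial in
/-- Algebra homomorphisms out of a polynomial ring determined by commuting elements. -/
theorem MvPolynomial.exists_algHom_of_commute {R ι A : Type*} [CommRing R] [Ring A] [Algebra R A]
    (f : ι → A) (h : ∀ i j, f i * f j = f j * f i) :
    ∃ Φ : MvPolynomial ι R →ₐ[R] A, ∀ i, Φ (X i) = f i := by
  have := Algebra.isMulCommutative_adjoin R (s := Set.range f)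
    (by rintro _ ⟨i, rfl⟩ _ ⟨j, rfl⟩; exact h i j)
  let g : ι → Algebra.adjoin R (Set.range f) :=
    fun i => ⟨f i, Algebra.subset_adjoin ⟨i, rfl⟩⟩
  exact ⟨(Algebra.adjoin R (Set.range f)).val.comp (aeval g), fun i => by simp [g]⟩

open MvPolynomial smoothSupportedOn in
/-- The functional sending a polynomial `q` to `(q(∂) F)(0)`. -/
theorem exists_taylor_functional {ι : Type*} [Fintype ι] [DecidableEq ι] {U : Set (ι → ℝ)}
    (hU : IsOpen U) (h0 : 0 ∈ U) {F : (ι → ℝ) → ℝ} (hF : ContDiffOn ℝ ∞ F U) :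
    ∃ L : MvPolynomial ι ℝ →ₗ[ℝ] ℝ, L 1 = F 0 ∧
      (∀ (z : ι → ℝ) (k : ℕ), iteratedDeriv k (fun t : ℝ => F (t • z)) 0 =
        L ((∑ a, C (z a) * X a) ^ k)) ∧
      ∀ {κ : Type} [Fintype κ] (c : κ → ℝ) (ℓ : κ → (ι → ℝ) →L[ℝ] ℝ) (v : κ → ι) (s : ℝ),
        (∀ x ∈ U, ∑ k, (c k + ℓ k x) * fderiv ℝ F x (Pi.single (v k) 1) = s * F x) →
        ∀ q, ∑ k, (c k * L (X (v k) * q) +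
          L (X (v k) * ∑ b, C (ℓ k (Pi.single b 1)) * pderiv b q)) = s * L q := by
  obtain ⟨Φ, hΦ⟩ := exists_algHom_of_commute (R := ℝ)
    (fun a : ι => dirDeriv hU (Pi.single a 1)) fun i j => dirDeriv_comm hU _ _
  let F₀ : smoothSupportedOn U := ⟨U.indicator F, indicator_mem hF⟩
  have hF₀ : ∀ x ∈ U, F₀.1 x = F x := fun x hx => Set.indicator_of_mem hx F
  have hfF₀ : ∀ x ∈ U, fderiv ℝ F₀.1 x = fderiv ℝ F x := fun x hx => by
    apply Filter.EventuallyEq.fderiv_eq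
    filter_upwards [hU.mem_nhds hx] with y hy
    exact hF₀ y hy
  let ev : smoothSupportedOn U →ₗ[ℝ] ℝ :=
    { toFun := fun G => G.1 0, map_add' := fun _ _ => rfl, map_smul' := fun _ _ => rfl }
  let L : MvPolynomial ι ℝ →ₗ[ℝ] ℝ :=
    { toFun := fun q => ev (Φ q F₀)
      map_add' := fun p q => by simp
      map_smul' := fun c q => by simp }
  have hL : ∀ q, L q = (Φ q F₀).1 0 := fun _ => rfl
  refine ⟨L, ?_, ?_, ?_⟩
  · rw [hL, map_one]; exact hF₀ 0 h0
  · intro z k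
    have hlin (G : smoothSupportedOn U) {x : ι → ℝ} (hx : x ∈ U) :
        (Φ (∑ a, C (z a) * X a) G).1 x = fderiv ℝ G.1 x z := by
      have e1 : Φ (∑ a, C (z a) * X a) = ∑ a, z a • dirDeriv hU (Pi.single a 1) := by
        simp_rw [map_sum, C_mul', map_smul, hΦ]
      have e2 : z = ∑ a, z a • (Pi.single a 1 : ι → ℝ) := by
        ext i; simp [Finset.sum_apply, Pi.single_apply]
      conv_rhs => rw [e2, map_sum]
      rw [e1, LinearMap.sum_apply, Submodule.coe_sum, Finset.sum_apply]
      refine Finset.sum_congr rfl fun a _ => ?_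
      rw [map_smul, LinearMap.smul_apply, Submodule.coe_smul, Pi.smul_apply,
        dirDeriv_apply hU _ _ hx]
    have key : ∀ k : ℕ, ∀ᶠ t in nhds (0 : ℝ), iteratedDeriv k (fun t : ℝ => F (t • z)) t =
        (Φ ((∑ a, C (z a) * X a) ^ k) F₀).1 (t • z) := by
      have hopen : IsOpen {t : ℝ | t • z ∈ U} := hU.preimage (by fun_prop)
      have hmem : ∀ᶠ t in nhds (0 : ℝ), t • z ∈ U := hopen.mem_nhds (by simpa using h0)
      intro k
      induction k with
      | zero => filter_upwards [hmem] with t ht; simp [hF₀ _ ht]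
      | succ k ih =>
        filter_upwards [ih.eventually_nhds, hmem] with t ht htU
        rw [iteratedDeriv_succ, Filter.EventuallyEq.deriv_eq ht, pow_succ', map_mul,
          Module.End.mul_apply, hlin _ htU]
        have h1 := (differentiableAt hU (Φ ((∑ a, C (z a) * X a) ^ k) F₀) htU).hasFDerivAt
        have h2 : HasDerivAt (fun t : ℝ => t • z) z t := by
          simpa using (hasDerivAt_id t).smul_const z
        exact (h1.comp_hasDerivAt t h2).deriv
    have := (key k).self_of_nhds
    simpa [hL] using this
  · intro κ _ c ℓ v s hPDE q
    have hcomm (ℓ : (ι → ℝ) →L[ℝ] ℝ) (q : MvPolynomial ι ℝ) :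
        Φ q * mulLinear ℓ = mulLinear ℓ * Φ q +
          Φ (∑ b, C (ℓ (Pi.single b 1)) * pderiv b q) := by
      induction q using MvPolynomial.induction_on with
      | C a =>
        have : Φ (C a) = algebraMap ℝ _ a := Φ.commutes a
        simp only [this, pderiv_C, mul_zero, Finset.sum_const_zero, map_zero, add_zero]
        exact Algebra.commutes a _
      | add p q hp hq =>
        simp only [map_add, mul_add, add_mul, hp, hq, Finset.sum_add_distrib]
        abel
      | mul_X p i hp =>
        have e : (∑ b, C (ℓ (Pi.single b 1)) * pderiv b (p * X i)) =
            (∑ b, C (ℓ (Pi.single b 1)) * pderiv b p) * X i + ℓ (Pi.single i 1) • p := by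
          simp only [pderiv_mul, pderiv_X, mul_add, Finset.sum_add_distrib, Finset.sum_mul,
            mul_assoc]
          congr 1
          rw [Finset.sum_eq_single i]
          · simp [C_mul']
          · intro b _ hb
            rw [Pi.single_eq_of_ne hb.symm]; simp
          · simp
        rw [e, map_add, map_mul, map_mul, map_smul, hΦ, mul_assoc, dirDeriv_mul_mulLinear,
          mul_add, ← mul_assoc, hp, mul_smul_comm, mul_one, add_mul]
        simp only [mul_assoc, add_assoc]
    have hEq : ∑ k, (c k • dirDeriv hU (Pi.single (v k) 1) F₀ +
        mulLinear (ℓ k) (dirDeriv hU (Pi.single (v k) 1) F₀)) = s • F₀ := by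
      ext x
      rw [Submodule.coe_sum, Finset.sum_apply]
      by_cases hx : x ∈ U
      · have := hPDE x hx
        simp only [Submodule.coe_add, Submodule.coe_smul, Pi.add_apply, Pi.smul_apply, smul_eq_mul]
        rw [hF₀ x hx, ← this]
        refine Finset.sum_congr rfl fun k _ => ?_
        rw [add_mul, ← hfF₀ x hx, ← dirDeriv_apply hU _ _ hx]
        rfl
      · rw [Submodule.coe_smul, Pi.smul_apply, F₀.2.2 x hx, smul_zero]
        exact Finset.sum_eq_zero fun k _ => Subtype.prop (_ : smoothSupportedOn U) |>.2 x hx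
    have h1 := congrArg (fun G => ev (Φ q G)) hEq
    simp only [map_sum, map_add, map_smul, smul_eq_mul] at h1
    rw [show s * L q = s * ev (Φ q F₀) from rfl, ← h1]
    refine Finset.sum_congr rfl fun k _ => ?_
    have h2 : Φ q (mulLinear (ℓ k) (dirDeriv hU (Pi.single (v k) 1) F₀)) =
        mulLinear (ℓ k) (Φ q (dirDeriv hU (Pi.single (v k) 1) F₀)) +
        Φ (∑ b, C (ℓ k (Pi.single b 1)) * pderiv b q) (dirDeriv hU (Pi.single (v k) 1) F₀) := by
      have := congrArg (fun T => T (dirDeriv hU (Pi.single (v k) 1) F₀)) (hcomm (ℓ k) q)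
      simpa using this
    have h3 : ev (mulLinear (ℓ k) (Φ q (dirDeriv hU (Pi.single (v k) 1) F₀))) = 0 := by
      simp [ev, mulLinear]
    have h4 (p : MvPolynomial ι ℝ) :
        ev (Φ p (dirDeriv hU (Pi.single (v k) 1) F₀)) = L (X (v k) * p) := by
      rw [mul_comm]
      change _ = ev (Φ (p * X (v k)) F₀)
      rw [map_mul, hΦ, Module.End.mul_apply]
    rw [h2, map_add, h3, zero_add, h4, h4]

namespace SymmetricDet

open Matrix

variable {n : Type*} [Fintype n]

/-- The symmetric part of a matrix given as a function on pairs. -/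
noncomputable def symmPart : (n × n → ℝ) →L[ℝ] (n × n → ℝ) :=
  LinearMap.toContinuousLinearMap
    { toFun := fun Z a => (Z a + Z a.swap) / 2
      map_add' := fun Z W => by ext a; simp; ring
      map_smul' := fun c Z => by ext a; simp; ring }

theorem symmPart_apply (Z : n × n → ℝ) (a : n × n) : symmPart Z a = (Z a + Z a.swap) / 2 := rfl

variable [DecidableEq n]

/-- The determinant of a square matrix given as a function on pairs. -/
noncomputable def curryDet (Y : n × n → ℝ) : ℝ := (Matrix.of fun i j => Y (i, j)).det

/-- The function `Z ↦ det(1 + (Z + Zᵀ)/2)`. -/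
noncomputable def shiftedDet (Z : n × n → ℝ) : ℝ :=
  curryDet ((fun a => if a.1 = a.2 then 1 else 0) + symmPart Z)

theorem contDiff_curryDet : ContDiff ℝ ∞ (curryDet (n := n)) := by
  unfold curryDet
  simp only [det_apply, Units.smul_def, zsmul_eq_mul, of_apply]
  refine ContDiff.sum fun σ _ => contDiff_const.mul (contDiff_prod fun i _ => ?_)
  fun_prop

theorem contDiff_shiftedDet : ContDiff ℝ ∞ (shiftedDet (n := n)) :=
  contDiff_curryDet.comp (contDiff_const.add (symmPart (n := n)).contDiff)

theorem shiftedDet_zero : shiftedDet (0 : n × n → ℝ) = 1 := by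
  rw [shiftedDet, map_zero, add_zero, curryDet]
  exact det_one

theorem det_one_add_single (i j : n) (t : ℝ) :
    (1 + single i j t).det = 1 + t * (if i = j then 1 else 0) := by
  have : single i j t =
      replicateCol Unit (Pi.single i t) * replicateRow Unit (Pi.single j 1 : n → ℝ) := by
    rw [← vecMulVec_eq]
    ext a b
    simp [vecMulVec, single_apply, Pi.single_apply, ← ite_and, eq_comm, and_comm]
  rw [this, det_one_add_replicateCol_mul_replicateRow]
  simp [Pi.single_apply]

theorem hasDerivAt_curryDet_line {Y : n × n → ℝ} {w : n × n → ℝ} {c : ℝ}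
    (h : ∀ t : ℝ, curryDet (Y + t • w) = curryDet Y * (1 + t * c)) :
    fderiv ℝ curryDet Y w = curryDet Y * c := by
  have h1 := (contDiff_curryDet.differentiable (by simp) Y).hasFDerivAt.hasLineDerivAt w
  have h2 : HasDerivAt (fun t : ℝ => curryDet Y * (1 + t * c)) (curryDet Y * c) 0 := by
    simpa using (((hasDerivAt_id (0 : ℝ)).mul_const c).const_add 1).const_mul (curryDet Y)
  unfold HasLineDerivAt at h1
  simp only [h] at h1
  exact h1.unique h2

theorem fderiv_curryDet_right (Y : n × n → ℝ) (i j : n) :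
    fderiv ℝ curryDet Y (fun a => if a.2 = j then Y (a.1, i) else 0) =
      curryDet Y * (if i = j then 1 else 0) := by
  apply hasDerivAt_curryDet_line
  intro t
  rw [← det_one_add_single, curryDet, curryDet, ← det_mul]
  congr 1
  ext a b
  by_cases hb : b = j
  · subst hb; simp [Matrix.mul_add, mul_single_apply_same, mul_comm]
  · simp [Matrix.mul_add, hb]

theorem fderiv_curryDet_left (Y : n × n → ℝ) (i j : n) :
    fderiv ℝ curryDet Y (fun a => if a.1 = j then Y (i, a.2) else 0) =
      curryDet Y * (if i = j then 1 else 0) := by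
  apply hasDerivAt_curryDet_line
  intro t
  have := det_one_add_single j i t
  rw [eq_comm] at this
  simp only [eq_comm (a := i)]
  rw [this, curryDet, curryDet, mul_comm, ← det_mul]
  congr 1
  ext a b
  by_cases hb : a = j
  · subst hb; simp [Matrix.add_mul, single_mul_apply_same]
  · simp [Matrix.add_mul, hb]

theorem sum_mul_fderiv_shiftedDet_rpow (s : ℝ) {Z : n × n → ℝ} (hZ : 0 < shiftedDet Z)
    (i j : n) :
    ∑ k, ((if i = k then 1 else 0) + (Z (i, k) + Z (k, i)) / 2) *
        fderiv ℝ (fun Z => shiftedDet Z ^ s) Z (Pi.single (k, j) 1) =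
      (s * (if i = j then 1 else 0)) * shiftedDet Z ^ s := by
  set Y : n × n → ℝ := (fun a => if a.1 = a.2 then 1 else 0) + symmPart Z with hY
  have hYs (a b : n) : Y (a, b) = (if a = b then 1 else 0) + (Z (a, b) + Z (b, a)) / 2 := by
    simp [hY, symmPart_apply]
  have hYsymm (a b : n) : Y (a, b) = Y (b, a) := by
    rw [hYs, hYs, add_comm (Z _)]; simp [eq_comm]
  have hd : HasFDerivAt shiftedDet ((fderiv ℝ curryDet Y).comp symmPart) Z := by
    have h1 := (contDiff_curryDet (n := n).differentiable (by simp) Y).hasFDerivAt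
    exact h1.comp Z (symmPart.hasFDerivAt.const_add _)
  rw [(hd.rpow_const (Or.inl hZ.ne')).fderiv]
  simp only [← hYs]
  have hw : ∑ k, Y (i, k) • symmPart (Pi.single (k, j) 1) =
      (1 / 2 : ℝ) • ((fun a => if a.2 = j then Y (a.1, i) else 0) +
        (fun a => if a.1 = j then Y (i, a.2) else 0)) := by
    ext ⟨a, b⟩
    simp only [Finset.sum_apply, Pi.smul_apply, Pi.add_apply, smul_eq_mul, symmPart_apply,
      Prod.swap_prod_mk, Pi.single_apply, Prod.mk.injEq, ite_and]
    simp only [add_div, mul_add, Finset.sum_add_distrib, ite_div, mul_ite, zero_div, mul_zero,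
      Finset.sum_ite_eq, Finset.mem_univ, if_true]
    rw [hYsymm a i]
    split_ifs <;> ring
  have hfd : ∑ k, Y (i, k) * fderiv ℝ curryDet Y (symmPart (Pi.single (k, j) 1)) =
      curryDet Y * (if i = j then 1 else 0) := by
    simp only [← smul_eq_mul (a := Y _), ← map_smul, ← map_sum]
    rw [map_sum]
    simp only [map_smul]
    rw [hw, map_smul, map_add, fderiv_curryDet_right, fderiv_curryDet_left, smul_eq_mul]
    ring
  have hp : shiftedDet Z ^ s = shiftedDet Z ^ (s - 1) * curryDet Y := by
    rw [show curryDet Y = shiftedDet Z from rfl, ← Real.rpow_add_one hZ.ne', sub_add_cancel]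
  simp only [_root_.smul_apply, ContinuousLinearMap.comp_apply, smul_eq_mul]
  rw [hp]
  calc _ = s * shiftedDet Z ^ (s - 1) *
        ∑ k, Y (i, k) * fderiv ℝ curryDet Y (symmPart (Pi.single (k, j) 1)) := by
        rw [Finset.mul_sum]; exact Finset.sum_congr rfl fun k _ => by ring
    _ = _ := by rw [hfd]; ring

theorem isOpen_shiftedDet_pos : IsOpen {Z : n × n → ℝ | 0 < shiftedDet Z} :=
  isOpen_lt continuous_const contDiff_shiftedDet.continuous

open MvPolynomial in
theorem exists_steinFunctional (m : ℕ) (s : ℝ) :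
    ∃ L : MvPolynomial (Fin m × Fin m) ℝ →ₗ[ℝ] ℝ, SteinIdentity s L ∧ L 1 = 1 ∧
      ∀ (z : Fin m × Fin m → ℝ) (k : ℕ),
        iteratedDeriv k (fun t : ℝ => shiftedDet (t • z) ^ s) 0 =
          L ((∑ a, C (z a) * X a) ^ k) := by
  obtain ⟨L, h1, hk, hS⟩ := exists_taylor_functional
    (U := {Z : Fin m × Fin m → ℝ | 0 < shiftedDet Z}) isOpen_shiftedDet_pos
    (by simp [shiftedDet_zero]) (F := fun Z => shiftedDet Z ^ s)
    (contDiff_shiftedDet.contDiffOn.rpow_const_of_ne fun Z hZ => (ne_of_gt hZ))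
  refine ⟨L, fun i j q => ?_, by simpa [shiftedDet_zero] using h1, hk⟩
  have := hS (fun k => if i = k then 1 else 0)
    (fun k => (1 / 2 : ℝ) • (ContinuousLinearMap.proj (R := ℝ) (φ := fun _ => ℝ) (i, k) +
      ContinuousLinearMap.proj (R := ℝ) (φ := fun _ => ℝ) (k, i))) (fun k => (k, j))
    (s * (if i = j then 1 else 0)) (fun Z hZ => by
      rw [← sum_mul_fderiv_shiftedDet_rpow s hZ]
      refine Finset.sum_congr rfl fun k _ => ?_
      congr 2
      simp; ring) q
  have hsymm (k : Fin m) : ∑ b, C (((1 / 2 : ℝ) •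
      (ContinuousLinearMap.proj (R := ℝ) (φ := fun _ : Fin m × Fin m => ℝ) (i, k) +
      ContinuousLinearMap.proj (R := ℝ) (φ := fun _ => ℝ) (k, i))) (Pi.single b 1)) *
        pderiv b q = symmPDeriv i k q := by
    simp only [_root_.smul_apply, _root_.add_apply,
      ContinuousLinearMap.proj_apply, smul_eq_mul, C_mul', symmPDeriv, Derivation.smul_apply,
      Derivation.add_apply, Pi.single_apply, add_smul, Finset.sum_add_distrib,
      mul_ite, ite_smul, mul_zero, mul_one, zero_smul, Finset.sum_ite_eq, Finset.mem_univ,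
      if_true, smul_add]
  simp only [hsymm] at this
  rw [Finset.sum_add_distrib] at this
  simp only [ite_mul, one_mul, zero_mul, Finset.sum_ite_eq, Finset.mem_univ, if_true] at this
  linarith

end SymmetricDet

section AbsolutelyMonotone

open Set Filter Topology

theorem taylorWithinEval_uIcc_eq_sum {g : ℝ → ℝ} {a b : ℝ} (hab : a < b)
    (hg : ContDiffAt ℝ ∞ g a) (n : ℕ) (x : ℝ) :
    taylorWithinEval g n (uIcc a b) a x =
      ∑ k ∈ Finset.range (n + 1), iteratedDeriv k g a * (x - a) ^ k / k.factorial := by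
  rw [taylor_within_apply]
  refine Finset.sum_congr rfl fun k _ => ?_
  rw [iteratedDerivWithin_eq_iteratedDeriv (uniqueDiffOn_uIcc hab.ne)
    (hg.of_le (by exact_mod_cast le_top)) left_mem_uIcc, smul_eq_mul]
  ring

/-- A single Taylor term bounds an absolutely monotone function from below. -/
theorem iteratedDeriv_mul_pow_le {g : ℝ → ℝ} {a b : ℝ} (hab : a < b)
    (hg : ∀ t ∈ Icc a b, ContDiffAt ℝ ∞ g t)
    (hpos : ∀ k : ℕ, ∀ t ∈ Icc a b, 0 ≤ iteratedDeriv k g t) (n : ℕ) :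
    iteratedDeriv n g a * (b - a) ^ n / n.factorial ≤ g b := by
  have hI : uIcc a b = Icc a b := uIcc_of_le hab.le
  obtain ⟨ξ, hξ, h⟩ := taylor_mean_remainder_lagrange_iteratedDeriv (f := g) (n := n) hab.ne
    (fun t ht => ((hg t (hI ▸ ht)).of_le (by exact_mod_cast le_top)).contDiffWithinAt)
  rw [taylorWithinEval_uIcc_eq_sum hab (hg a (left_mem_Icc.2 hab.le))] at h
  rw [uIoo_of_lt hab] at hξ
  have hr : 0 ≤ iteratedDeriv (n + 1) g ξ * (b - a) ^ (n + 1) / ((n + 1).factorial : ℝ) := by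
    have := hpos (n + 1) ξ (Ioo_subset_Icc_self hξ)
    have := sub_nonneg.2 hab.le
    positivity
  have hs : iteratedDeriv n g a * (b - a) ^ n / n.factorial ≤
      ∑ k ∈ Finset.range (n + 1), iteratedDeriv k g a * (b - a) ^ k / k.factorial := by
    refine Finset.single_le_sum
      (f := fun k : ℕ => iteratedDeriv k g a * (b - a) ^ k / (k.factorial : ℝ))
      (fun k _ => ?_) (by simp)
    have := hpos k a (left_mem_Icc.2 hab.le)
    have := sub_nonneg.2 hab.le
    positivity
  linarith

/-- The Taylor series at `0` of a function that is absolutely monotone on `[0, b]` converges to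
the function at `1` when `1 < b`. -/
theorem tendsto_taylor_sum_of_iteratedDeriv_nonneg {g : ℝ → ℝ} {b : ℝ} (hb : 1 < b)
    (hg : ∀ t ∈ Icc 0 b, ContDiffAt ℝ ∞ g t)
    (hpos : ∀ k : ℕ, ∀ t ∈ Icc 0 b, 0 ≤ iteratedDeriv k g t) :
    Tendsto (fun n : ℕ => ∑ k ∈ Finset.range (n + 1), iteratedDeriv k g 0 / k.factorial)
      atTop (𝓝 (g 1)) := by
  have hb0 : 0 < b := by linarith
  have hgb : 0 ≤ g b := by simpa using hpos 0 b (right_mem_Icc.2 hb0.le)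
  have hI : uIcc (0 : ℝ) 1 = Icc 0 1 := uIcc_of_le zero_le_one
  have hsub : Icc (0 : ℝ) 1 ⊆ Icc 0 b := Icc_subset_Icc_right hb.le
  have hbound (n : ℕ) : |g 1 - ∑ k ∈ Finset.range (n + 1), iteratedDeriv k g 0 / k.factorial| ≤
      g b / (b - 1) * ((n + 1 : ℕ) * (b⁻¹) ^ n) := by
    obtain ⟨ξ, hξ, h⟩ := taylor_mean_remainder_cauchy (f := g) (n := n) (zero_ne_one)
      (fun t ht => ((hg t (hsub (hI ▸ ht))).of_le (by exact_mod_cast le_top)).contDiffWithinAt)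
      (by
        refine DifferentiableOn.mono ?_ uIoo_subset_uIcc_self
        refine ContDiffOn.differentiableOn_iteratedDerivWithin (n := ∞) ?_
          (by exact_mod_cast ENat.natCast_lt_top n) (uniqueDiffOn_uIcc zero_ne_one)
        exact fun t ht => (hg t (hsub (hI ▸ ht))).contDiffWithinAt)
    rw [taylorWithinEval_uIcc_eq_sum zero_lt_one (hg 0 (left_mem_Icc.2 hb0.le)),
      iteratedDerivWithin_eq_iteratedDeriv (uniqueDiffOn_uIcc zero_ne_one)
        ((hg ξ (hsub (hI ▸ uIoo_subset_uIcc_self hξ))).of_le (by exact_mod_cast le_top))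
        (uIoo_subset_uIcc_self hξ)] at h
    simp only [sub_zero, one_pow, mul_one] at h
    rw [uIoo_of_lt zero_lt_one] at hξ
    rw [h]
    obtain ⟨hξ0, hξ1⟩ := hξ
    have h1 : 0 < 1 - ξ := by linarith
    have h2 : 0 < b - ξ := by linarith
    have hD := hpos (n + 1) ξ ⟨hξ0.le, by linarith⟩
    have hle := iteratedDeriv_mul_pow_le (show ξ < b by linarith)
      (fun t ht => hg t ⟨hξ0.le.trans ht.1, ht.2⟩)
      (fun k t ht => hpos k t ⟨hξ0.le.trans ht.1, ht.2⟩) (n + 1)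
    rw [abs_of_nonneg (by positivity)]
    have hD' : iteratedDeriv (n + 1) g ξ ≤ g b * (n + 1).factorial / (b - ξ) ^ (n + 1) := by
      rw [le_div_iff₀ (by positivity)]
      rwa [div_le_iff₀ (by positivity)] at hle
    have hq : (1 - ξ) / (b - ξ) ≤ b⁻¹ := by
      rw [← one_div, div_le_div_iff₀ h2 hb0]
      nlinarith
    calc iteratedDeriv (n + 1) g ξ * (1 - ξ) ^ n / n.factorial
        ≤ g b * (n + 1).factorial / (b - ξ) ^ (n + 1) * (1 - ξ) ^ n / n.factorial := by gcongr
      _ = g b / (b - ξ) * ((n + 1 : ℕ) * ((1 - ξ) / (b - ξ)) ^ n) := by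
          rw [Nat.factorial_succ, pow_succ, div_pow]
          push_cast
          field_simp
      _ ≤ g b / (b - 1) * ((n + 1 : ℕ) * (b⁻¹) ^ n) := by
          gcongr
  have hlim : Tendsto (fun n : ℕ => g b / (b - 1) * ((n + 1 : ℕ) * (b⁻¹) ^ n)) atTop (𝓝 0) := by
    have hr : |b⁻¹| < 1 := by rw [abs_of_pos (by positivity)]; exact inv_lt_one_of_one_lt₀ hb
    have t1 := tendsto_self_mul_const_pow_of_abs_lt_one hr
    have t2 := tendsto_pow_atTop_nhds_zero_of_abs_lt_one hr
    have := (t1.add t2).const_mul (g b / (b - 1))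
    simp only [add_zero, mul_zero] at this
    refine this.congr fun n => ?_
    push_cast; ring
  have := squeeze_zero_norm (a := fun n : ℕ => g b / (b - 1) * ((n + 1 : ℕ) * (b⁻¹) ^ n))
    (f := fun n : ℕ => g 1 - ∑ k ∈ Finset.range (n + 1), iteratedDeriv k g 0 / k.factorial)
    (t₀ := atTop) hbound hlim
  simpa using (tendsto_const_nhds (x := g 1)).sub this

end AbsolutelyMonotone

section Line

variable {E : Type*} [NormedAddCommGroup E] [NormedSpace ℝ E]

theorem iteratedDeriv_comp_line {f : E → ℝ} {U : Set E} (hU : IsOpen U)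
    (hf : ContDiffOn ℝ ∞ f U) (x v : E) (k : ℕ) {t : ℝ} (ht : x + t • v ∈ U) :
    iteratedDeriv k (fun t : ℝ => f (x + t • v)) t =
      iteratedFDeriv ℝ k f (x + t • v) (fun _ => v) := by
  have hopen : IsOpen {t : ℝ | x + t • v ∈ U} := hU.preimage (by fun_prop)
  induction k generalizing t with
  | zero => simp
  | succ k ih =>
    have he : iteratedDeriv k (fun t : ℝ => f (x + t • v)) =ᶠ[nhds t]
        fun t => iteratedFDeriv ℝ k f (x + t • v) (fun _ => v) := by
      filter_upwards [hopen.mem_nhds ht] with t ht using ih ht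
    rw [iteratedDeriv_succ, he.deriv_eq, iteratedFDeriv_succ_apply_left]
    have hd : DifferentiableAt ℝ (iteratedFDeriv ℝ k f) (x + t • v) :=
      (hf.contDiffAt (hU.mem_nhds ht)).differentiableAt_iteratedFDeriv
        (by exact_mod_cast ENat.natCast_lt_top k)
    have h2 : HasDerivAt (fun t : ℝ => x + t • v) v t := by
      simpa using ((hasDerivAt_id t).smul_const v).const_add x
    have h3 := hd.hasFDerivAt.comp_hasDerivAt t h2
    have h4 := (ContinuousMultilinearMap.apply ℝ (fun _ : Fin k => E) ℝ (fun _ => v)).hasFDerivAt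
      |>.comp_hasDerivAt t h3
    exact h4.deriv

theorem contDiffAt_comp_line {f : E → ℝ} {U : Set E} (hU : IsOpen U)
    (hf : ContDiffOn ℝ ∞ f U) (x v : E) {t : ℝ} (ht : x + t • v ∈ U) :
    ContDiffAt ℝ ∞ (fun t : ℝ => f (x + t • v)) t :=
  (hf.contDiffAt (hU.mem_nhds ht)).comp t
    (contDiffAt_const.add (contDiffAt_id.smul contDiffAt_const))

end Line

namespace CompletelyMonotoneOn

open Filter Topology Set

variable {E : Type*} [NormedAddCommGroup E] [NormedSpace ℝ E] {f : E → ℝ} {C : Set E}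

theorem iteratedFDeriv_nonneg (hf : CompletelyMonotoneOn f C) (hC : IsOpen C) (k : ℕ)
    (u : Fin k → E) (hu : ∀ i, u i ∈ C) {x : E} (hx : x ∈ C) :
    0 ≤ (-1 : ℝ) ^ k * iteratedFDeriv ℝ k f x u := by
  have := hf.2 k u hu x hx
  rwa [iteratedFDerivWithin_of_isOpen k hC hx] at this

theorem sum_mem_cone (hconv : Convex ℝ C) (hcone : ∀ x ∈ C, ∀ t : ℝ, 0 < t → t • x ∈ C)
    {κ : Type*} {s : Finset κ} (hs : s.Nonempty) {t : κ → ℝ} (ht : ∀ i ∈ s, 0 < t i) {x : κ → E}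
    (hx : ∀ i ∈ s, x i ∈ C) : ∑ i ∈ s, t i • x i ∈ C := by
  have hadd : ∀ a ∈ C, ∀ b ∈ C, a + b ∈ C := fun a ha b hb => by
    have := hcone _ (hconv ha hb (a := 1 / 2) (b := 1 / 2) (by norm_num) (by norm_num)
      (by norm_num)) 2 two_pos
    rwa [smul_add, smul_smul, smul_smul, mul_one_div_cancel two_ne_zero, one_smul, one_smul] at this
  exact Finset.sum_induction_nonempty _ (· ∈ C) (fun a b ha hb => hadd a ha b hb) hs
    fun i hi => hcone _ (hx i hi) _ (ht i hi)

/-- Weights used to approximate the kernel `(a, b) ↦ f (x a + x b)`. -/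
noncomputable def weight {κ : Type*} [DecidableEq κ] (R : ℝ) (a i : κ) : ℝ :=
  1 - (if a = i then 1 else 0) / R

theorem sum_weight_smul {κ : Type*} [Fintype κ] [DecidableEq κ] {R : ℝ} (hR : 1 < R)
    (x : κ → E) (a b : κ) :
    (R • ∑ i, x i) + (1 : ℝ) • -(R • ∑ i, (weight R a i * weight R b i) • x i) =
      x a + x b - (if a = b then R⁻¹ else 0) • x a := by
  have hR0 : R ≠ 0 := by linarith
  have : ∀ i, R • x i - R • (weight R a i * weight R b i) • x i =
      (if a = i then x i else 0) + (if b = i then x i else 0) -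
        (if a = i then (if a = b then R⁻¹ else 0) • x i else 0) := by
    intro i
    by_cases ha : a = i
    · subst ha
      by_cases hb : a = b
      · subst hb
        simp only [weight, if_true, smul_smul, ← sub_smul, ← two_smul ℝ (x a)]
        congr 1; field_simp; ring
      · simp only [weight, if_true, if_neg hb, if_neg (Ne.symm hb), smul_smul, ← sub_smul]
        rw [zero_smul, sub_zero, add_zero]
        conv_rhs => rw [← one_smul ℝ (x a)]
        congr 1; field_simp; ring
    · by_cases hb : b = i
      · subst hb
        simp only [weight, if_true, if_neg ha, smul_smul, ← sub_smul]
        rw [sub_zero, zero_add]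
        conv_rhs => rw [← one_smul ℝ (x b)]
        congr 1; field_simp; ring
      · simp [weight, ha, hb]
  rw [one_smul, ← sub_eq_add_neg, Finset.smul_sum, Finset.smul_sum, ← Finset.sum_sub_distrib,
    Finset.sum_congr rfl fun i _ => this i]
  simp [Finset.sum_add_distrib, Finset.sum_sub_distrib]

theorem sum_mul_iteratedFDeriv_nonneg (hf : CompletelyMonotoneOn f C) (hC : IsOpen C)
    {κ : Type*} [Fintype κ] {x : κ → E} (hx : ∀ a, x a ∈ C) (w : κ → κ → ℝ)
    (c : κ → ℝ) {R : ℝ} (hR : 0 < R) {p : E} (hp : p ∈ C) (k : ℕ) :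
    0 ≤ ∑ a, ∑ b, c a * c b *
      iteratedFDeriv ℝ k f p (fun _ => -(R • ∑ i, (w a i * w b i) • x i)) := by
  classical
  have h1 (a b : κ) : iteratedFDeriv ℝ k f p (fun _ => -(R • ∑ i, (w a i * w b i) • x i)) =
      ∑ I : Fin k → κ, R ^ k * (((-1) ^ k * iteratedFDeriv ℝ k f p fun j => x (I j)) *
        ((∏ j, w a (I j)) * ∏ j, w b (I j))) := by
    have e : (fun _ : Fin k => -(R • ∑ i, (w a i * w b i) • x i)) =
        fun j : Fin k => (-R) • (fun _ : Fin k => ∑ i, (w a i * w b i) • x i) j := by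
      ext j; simp
    rw [e, ContinuousMultilinearMap.map_smul_univ, ContinuousMultilinearMap.map_sum,
      Finset.smul_sum]
    refine Finset.sum_congr rfl fun I _ => ?_
    rw [ContinuousMultilinearMap.map_smul_univ, Finset.prod_const, Finset.card_univ,
      Fintype.card_fin, Finset.prod_mul_distrib, neg_pow]
    simp only [smul_eq_mul]
    ring
  have h2 : ∑ a, ∑ b, c a * c b *
      iteratedFDeriv ℝ k f p (fun _ => -(R • ∑ i, (w a i * w b i) • x i)) =
      ∑ I : Fin k → κ, R ^ k * (((-1) ^ k * iteratedFDeriv ℝ k f p fun j => x (I j)) *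
        (∑ a, c a * ∏ j, w a (I j)) ^ 2) := by
    simp only [h1, Finset.mul_sum, sq, Finset.sum_mul]
    rw [Finset.sum_congr rfl fun a _ => Finset.sum_comm, Finset.sum_comm]
    refine Finset.sum_congr rfl fun I _ => ?_
    rw [Finset.sum_comm]
    exact Finset.sum_congr rfl fun a _ => Finset.sum_congr rfl fun b _ => by ring
  rw [h2]
  refine Finset.sum_nonneg fun I _ => ?_
  have := hf.iteratedFDeriv_nonneg hC k (fun j => x (I j)) (fun j => hx _) hp
  positivity

/-- A completely monotone function on an open convex cone defines a positive semidefinite kernel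
`(x, y) ↦ f (x + y)`. -/
theorem sum_mul_apply_add_nonneg (hf : CompletelyMonotoneOn f C) (hC : IsOpen C)
    (hconv : Convex ℝ C) (hcone : ∀ x ∈ C, ∀ t : ℝ, 0 < t → t • x ∈ C)
    {κ : Type*} [Fintype κ] {x : κ → E} (hx : ∀ a, x a ∈ C) (c : κ → ℝ) :
    0 ≤ ∑ a, ∑ b, c a * c b * f (x a + x b) := by
  classical
  cases isEmpty_or_nonempty κ
  · simp
  have hfd : ContDiffOn ℝ ∞ f C := hf.1
  have hne : (Finset.univ : Finset κ).Nonempty := Finset.univ_nonempty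
  have hadd (a b : κ) (ε : ℝ) (hε : ε < 1) : x a + x b - ε • x a ∈ C := by
    have := sum_mem_cone hconv hcone (s := (Finset.univ : Finset (Fin 2))) ⟨0, by simp⟩
      (t := ![1 - ε, 1]) (x := ![x a, x b]) (by simp [Fin.forall_fin_two, hε])
      (by simp [Fin.forall_fin_two, hx])
    have e : x a + x b - ε • x a = (1 - ε) • x a + (1 : ℝ) • x b := by module
    rw [e]; simpa [Fin.sum_univ_two] using this
  have key (R : ℝ) (hR : 1 < R) :
      0 ≤ ∑ a, ∑ b, c a * c b * f (x a + x b - (if a = b then R⁻¹ else 0) • x a) := by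
    have hR0 : 0 < R := by linarith
    have hp : R • ∑ i, x i ∈ C := by
      have := sum_mem_cone hconv hcone hne (t := fun _ => R) (fun _ _ => hR0) fun i _ => hx i
      rwa [Finset.smul_sum]
    have hw (a b : κ) : R • ∑ i, (weight R a i * weight R b i) • x i ∈ C := by
      have hpos (a i : κ) : 0 < weight R a i := by
        rw [weight, sub_pos, div_lt_one hR0]; split_ifs <;> linarith
      exact hcone _ (sum_mem_cone hconv hcone hne
        (fun i _ => mul_pos (hpos a i) (hpos b i)) fun i _ => hx i) _ hR0
    have hlim (a b : κ) : Tendsto (fun n : ℕ => ∑ k ∈ Finset.range (n + 1),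
        iteratedFDeriv ℝ k f (R • ∑ i, x i)
          (fun _ => -(R • ∑ i, (weight R a i * weight R b i) • x i)) / k.factorial) atTop
        (𝓝 (f (x a + x b - (if a = b then R⁻¹ else 0) • x a))) := by
      set p := R • ∑ i, x i
      set v := -(R • ∑ i, (weight R a i * weight R b i) • x i) with hv
      have h1 : p + (1 : ℝ) • v = x a + x b - (if a = b then R⁻¹ else 0) • x a :=
        sum_weight_smul hR x a b
      have hR1 : R⁻¹ < 1 := inv_lt_one_of_one_lt₀ hR
      have hmem1 : p + (1 : ℝ) • v ∈ C := by
        rw [h1]; exact hadd a b _ (by split_ifs <;> [exact hR1; exact one_pos])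
      have hmem0 : p + (0 : ℝ) • v ∈ C := by simpa using hp
      have hopen : IsOpen {t : ℝ | p + t • v ∈ C} := hC.preimage (by fun_prop)
      obtain ⟨B, hB1, hB⟩ : ∃ B > (1 : ℝ), p + B • v ∈ C := by
        have : ∀ᶠ t in 𝓝[>] (1 : ℝ), p + t • v ∈ C :=
          nhdsWithin_le_nhds (hopen.mem_nhds hmem1)
        obtain ⟨B, hB, hB'⟩ := (this.and self_mem_nhdsWithin).exists
        exact ⟨B, hB', hB⟩
      have hseg : ∀ t ∈ Icc (0 : ℝ) B, p + t • v ∈ C := by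
        intro t ht
        have hB0 : 0 < B := by linarith
        have := hconv hmem0 hB (a := 1 - t / B) (b := t / B)
          (by rw [sub_nonneg, div_le_one hB0]; exact ht.2) (div_nonneg ht.1 hB0.le) (by ring)
        convert this using 1
        have : t = t / B * B := by field_simp
        conv_lhs => rw [this]
        module
      have := tendsto_taylor_sum_of_iteratedDeriv_nonneg (g := fun t : ℝ => f (p + t • v)) hB1
        (fun t ht => contDiffAt_comp_line hC hfd p v (hseg t ht))
        (fun k t ht => by
          rw [iteratedDeriv_comp_line hC hfd p v k (hseg t ht)]
          have h2 := hf.iteratedFDeriv_nonneg hC k (fun _ => -v)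
            (fun _ => by rw [hv, neg_neg]; exact hw a b) (hseg t ht)
          have e : (fun _ : Fin k => -v) = fun i : Fin k => (-1 : ℝ) • (fun _ : Fin k => v) i := by
            ext; simp
          rw [e, ContinuousMultilinearMap.map_smul_univ] at h2
          simpa [← mul_assoc, ← mul_pow] using h2)
      simp only [iteratedDeriv_comp_line hC hfd p v _ hmem0, h1] at this
      simpa only [zero_smul, add_zero] using this
    have hlim2 := tendsto_finsetSum Finset.univ fun a _ =>
      tendsto_finsetSum Finset.univ fun b _ => (hlim a b).const_mul (c a * c b)
    refine ge_of_tendsto' hlim2 fun n => ?_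
    have : ∑ a, ∑ b, c a * c b * ∑ k ∈ Finset.range (n + 1),
        iteratedFDeriv ℝ k f (R • ∑ i, x i)
          (fun _ => -(R • ∑ i, (weight R a i * weight R b i) • x i)) / k.factorial =
        ∑ k ∈ Finset.range (n + 1), (∑ a, ∑ b, c a * c b * iteratedFDeriv ℝ k f (R • ∑ i, x i)
          (fun _ => -(R • ∑ i, (weight R a i * weight R b i) • x i))) / k.factorial := by
      simp only [Finset.mul_sum, Finset.sum_div, mul_div_assoc]
      rw [Finset.sum_congr rfl fun a _ => Finset.sum_comm, Finset.sum_comm]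
    rw [this]
    exact Finset.sum_nonneg fun k _ => div_nonneg
      (hf.sum_mul_iteratedFDeriv_nonneg hC hx _ c hR0 hp k) (by positivity)
  have hlim : Tendsto (fun R : ℝ => ∑ a, ∑ b, c a * c b *
      f (x a + x b - (if a = b then R⁻¹ else 0) • x a)) atTop
      (𝓝 (∑ a, ∑ b, c a * c b * f (x a + x b))) := by
    refine tendsto_finsetSum _ fun a _ => tendsto_finsetSum _ fun b _ => ?_
    refine Tendsto.const_mul _ ?_
    have hc : ContinuousAt f (x a + x b) := by
      refine (hfd.continuousOn.continuousAt (hC.mem_nhds ?_))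
      simpa using hadd a b 0 one_pos
    refine hc.tendsto.comp ?_
    have : Tendsto (fun R : ℝ => if a = b then R⁻¹ else 0) atTop (𝓝 0) := by
      split_ifs
      · exact tendsto_inv_atTop_zero
      · exact tendsto_const_nhds
    simpa using (tendsto_const_nhds (x := x a + x b)).sub (this.smul_const (x a))
  exact ge_of_tendsto hlim ((eventually_gt_atTop 1).mono key)

end CompletelyMonotoneOn

namespace SymmetricDet

open Finset PowerSeries

section ExpSum

variable {R : Type*} [CommRing R] [Algebra ℚ R]

theorem rescale_exp_sum {ι : Type*} [DecidableEq ι] (S : Finset ι) (y : ι → R) :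
    rescale (∑ i ∈ S, y i) (exp R) = ∏ i ∈ S, rescale (y i) (exp R) := by
  induction S using Finset.induction_on with
  | empty => simp
  | insert i S hi ih =>
    rw [sum_insert hi, prod_insert hi, ← ih, ← exp_mul_exp_eq_exp_add]

theorem one_sub_rescale_exp (y : R) :
    ∃ q : R⟦X⟧, 1 - rescale y (exp R) = X * q ∧ constantCoeff q = -y := by
  obtain ⟨q, hq⟩ := X_dvd_iff.mpr (show constantCoeff (1 - rescale y (exp R)) = 0 by
    rw [map_sub, ← coeff_zero_eq_constantCoeff_apply, ← coeff_zero_eq_constantCoeff_apply,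
      coeff_rescale]
    simp)
  refine ⟨q, hq, ?_⟩
  have := congrArg (coeff 1) hq
  rw [map_sub, coeff_rescale, coeff_exp, show (1 : ℕ) = 0 + 1 from rfl, coeff_succ_X_mul,
    coeff_zero_eq_constantCoeff_apply] at this
  simpa [coeff_one] using this.symm

theorem exists_sum_sign_mul_rescale_exp {n : Type*} [Fintype n] [DecidableEq n]
    (M : Matrix n n R) :
    ∃ q : R⟦X⟧, constantCoeff q = (-M).det ∧
      ∑ a : Equiv.Perm n × Finset n, C (((Equiv.Perm.sign a.1 : ℤ) : R) * (-1) ^ #a.2) *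
        rescale (∑ i ∈ a.2, M (a.1 i) i) (exp R) = X ^ Fintype.card n * q := by
  choose q hq hq0 using one_sub_rescale_exp (R := R)
  refine ⟨∑ σ : Equiv.Perm n, C ((Equiv.Perm.sign σ : ℤ) : R) * ∏ i, q (M (σ i) i), ?_, ?_⟩
  · simp [Matrix.det_apply, hq0, Units.smul_def]
  · rw [Fintype.sum_prod_type, mul_sum]
    refine sum_congr rfl fun σ _ => ?_
    have h : ∏ i, (1 - rescale (M (σ i) i) (exp R)) =
        X ^ Fintype.card n * ∏ i, q (M (σ i) i) := by
      simp only [hq, prod_mul_distrib, prod_const, card_univ]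
    rw [mul_left_comm, ← h, prod_sub, mul_sum, powerset_univ]
    refine sum_congr rfl fun S _ => ?_
    rw [rescale_exp_sum]
    simp [mul_assoc]

theorem sum_sign_mul_sign_mul_add_pow {n : Type*} [Fintype n] [DecidableEq n]
    (M : Matrix n n R) {k : ℕ} (hk : k ≤ 2 * Fintype.card n) :
    ∑ a : Equiv.Perm n × Finset n, ∑ b : Equiv.Perm n × Finset n,
      (((Equiv.Perm.sign a.1 : ℤ) : R) * (-1) ^ #a.2) *
        (((Equiv.Perm.sign b.1 : ℤ) : R) * (-1) ^ #b.2) *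
        (∑ i ∈ a.2, M (a.1 i) i + ∑ i ∈ b.2, M (b.1 i) i) ^ k =
      if k = 2 * Fintype.card n then (k.factorial : R) * M.det ^ 2 else 0 := by
  obtain ⟨q, hq0, hq⟩ := exists_sum_sign_mul_rescale_exp M
  have h2 := congrArg (coeff k) (congrArg₂ (· * ·) hq hq)
  simp only [sum_mul_sum, map_sum] at h2
  have hf : (k.factorial : R) * algebraMap ℚ R (1 / k.factorial) = 1 := by
    rw [← map_natCast (algebraMap ℚ R), ← map_mul, mul_one_div_cancel (by positivity), map_one]
  have h3 := congrArg ((k.factorial : R) * ·) h2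
  simp only [mul_sum] at h3
  refine Eq.trans ?_ (h3.trans ?_)
  · refine sum_congr rfl fun a _ => sum_congr rfl fun b _ => ?_
    rw [mul_mul_mul_comm (C _), exp_mul_exp_eq_exp_add, ← map_mul, coeff_C_mul, coeff_rescale, coeff_exp]
    linear_combination (-1 : R) * (((Equiv.Perm.sign a.1 : ℤ) : R) * (-1) ^ #a.2 *
        (((Equiv.Perm.sign b.1 : ℤ) : R) * (-1) ^ #b.2)) *
        (∑ i ∈ a.2, M (a.1 i) i + ∑ i ∈ b.2, M (b.1 i) i) ^ k * hf
  · rw [show X ^ Fintype.card n * q * (X ^ Fintype.card n * q) =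
      X ^ (2 * Fintype.card n) * (q * q) by ring, coeff_X_pow_mul']
    split_ifs with h1 h2 h2
    · subst h2
      rw [Nat.sub_self, coeff_zero_eq_constantCoeff_apply, map_mul, hq0, Matrix.det_neg]
      rw [mul_mul_mul_comm, ← mul_pow]
      simp [pow_two]
    · omega
    · omega
    · simp

end ExpSum

end SymmetricDet

namespace SymmetricDet

open Finset Filter Topology

/-- A function of one variable whose derivatives at `0` of order less than `N` vanish and whose
`N`-th derivative at `0` is negative is negative to the right of `0`. -/
theorem eventually_neg_of_iteratedDeriv {g : ℝ → ℝ} {N : ℕ} (hg : ContDiffAt ℝ N g 0)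
    (h0 : ∀ k < N, iteratedDeriv k g 0 = 0) (hN : iteratedDeriv N g 0 < 0) :
    ∀ᶠ t in 𝓝[>] (0 : ℝ), g t < 0 := by
  obtain ⟨u, hu, hgu⟩ := hg.contDiffOn (m := N) le_rfl (by simp)
  obtain ⟨r, hr, hru⟩ := Metric.mem_nhds_iff.mp (by simpa using hu)
  have h := Real.taylor_tendsto (convex_ball (0 : ℝ) r) (Metric.mem_ball_self hr) (hgu.mono hru)
  rw [Metric.isOpen_ball.nhdsWithin_eq (Metric.mem_ball_self hr)] at h
  have hneg : -((N.factorial : ℝ)⁻¹ * iteratedDeriv N g 0) > 0 := by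
    have : (0 : ℝ) < (N.factorial : ℝ)⁻¹ := by positivity
    nlinarith
  filter_upwards [nhdsWithin_le_nhds (h.eventually (gt_mem_nhds hneg)), self_mem_nhdsWithin]
    with t ht ht0
  have ht0 : 0 < t := ht0
  rw [taylor_within_apply, sum_range_succ, sum_eq_zero fun k hk => by
      rw [iteratedDerivWithin_of_isOpen Metric.isOpen_ball (Metric.mem_ball_self hr),
        h0 k (mem_range.mp hk), smul_zero],
    iteratedDerivWithin_of_isOpen Metric.isOpen_ball (Metric.mem_ball_self hr), sub_zero,
    zero_add, smul_eq_mul, div_lt_iff₀ (by positivity)] at ht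
  linarith

/-- The `0`-`1` matrix, as a function on pairs, supported on the graph of `a.1` over `a.2`. -/
noncomputable def partialPerm {n : Type*} [DecidableEq n] (a : Equiv.Perm n × Finset n) :
    n × n → ℝ :=
  fun q => if q.2 ∈ a.2 ∧ a.1 q.2 = q.1 then 1 else 0

/-- The coefficient of `partialPerm a` in the test functional. -/
noncomputable def permSign {n : Type*} [Fintype n] [DecidableEq n]
    (a : Equiv.Perm n × Finset n) : ℝ :=
  (Equiv.Perm.sign a.1 : ℤ) * (-1) ^ #a.2

open MvPolynomial in
theorem sum_C_partialPerm_mul_X {n : Type*} [Fintype n] [DecidableEq n]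
    (a : Equiv.Perm n × Finset n) :
    ∑ q, C (partialPerm a q) * X q =
      ∑ i ∈ a.2, (Matrix.mvPolynomialX n n ℝ) (a.1 i) i := by
  rw [Fintype.sum_prod_type_right]
  simp only [partialPerm, ite_and, apply_ite C, C_1, C_0, ite_mul, one_mul, zero_mul,
    sum_ite_irrel, sum_const_zero, sum_ite_eq, mem_univ, if_true, Matrix.mvPolynomialX_apply,
    sum_ite_mem, univ_inter]

open MvPolynomial in
theorem eventually_sum_shiftedDet_rpow_neg {m : ℕ} {s : ℝ}
    (hs : ∏ k ∈ range m, ((s + k / 2) * (s - 1 + k / 2)) < 0) :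
    ∀ᶠ t in 𝓝[>] (0 : ℝ), ∑ a : Equiv.Perm (Fin m) × Finset (Fin m),
      ∑ b : Equiv.Perm (Fin m) × Finset (Fin m), permSign a * permSign b *
        shiftedDet (t • (partialPerm a + partialPerm b)) ^ s < 0 := by
  obtain ⟨L, hL, hL1, hLk⟩ := exists_steinFunctional m s
  have hsm (z : Fin m × Fin m → ℝ) {N : ℕ} :
      ContDiffAt ℝ N (fun t : ℝ => shiftedDet (t • z) ^ s) 0 := by
    refine ContDiffAt.rpow_const_of_ne (((contDiff_shiftedDet.of_le ?_).comp
      (contDiff_id.smul contDiff_const)).contDiffAt) (by simp [shiftedDet_zero])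
    exact_mod_cast le_top
  have hder (k : ℕ) (hk : k ≤ 2 * m) :
      iteratedDeriv k (fun t : ℝ => ∑ a : Equiv.Perm (Fin m) × Finset (Fin m),
        ∑ b : Equiv.Perm (Fin m) × Finset (Fin m), permSign a * permSign b *
          shiftedDet (t • (partialPerm a + partialPerm b)) ^ s) 0 =
      if k = 2 * m then (k.factorial : ℝ) * L ((Matrix.mvPolynomialX (Fin m) (Fin m) ℝ).det ^ 2)
        else 0 := by
    have h1 := congrArg L (sum_sign_mul_sign_mul_add_pow (Matrix.mvPolynomialX (Fin m) (Fin m) ℝ)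
      (k := k) (by simpa using hk))
    rw [iteratedDeriv_fun_sum fun a _ => ContDiffAt.sum fun b _ => contDiffAt_const.mul (hsm _)]
    have h2 : ∀ a ∈ (univ : Finset (Equiv.Perm (Fin m) × Finset (Fin m))), _ := fun a _ =>
      iteratedDeriv_fun_sum (n := k) (x := 0) (I := univ) (f := fun b (t : ℝ) =>
        permSign a * permSign b * shiftedDet (t • (partialPerm a + partialPerm b)) ^ s)
        fun b _ => contDiffAt_const.mul (hsm _)
    rw [sum_congr rfl h2]
    simp only [iteratedDeriv_const_mul_field, hLk, Pi.add_apply, C_add, add_mul,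
      sum_add_distrib, sum_C_partialPerm_mul_X]
    simp only [map_sum] at h1
    rw [Fintype.card_fin] at h1
    refine Eq.trans (sum_congr rfl fun a _ => sum_congr rfl fun b _ => ?_) (h1.trans ?_)
    · rw [← smul_eq_mul, ← map_smul, smul_eq_C_mul]
      simp [permSign]
    · rw [apply_ite L, map_zero, ← map_natCast (C : ℝ →+* MvPolynomial (Fin m × Fin m) ℝ),
        ← smul_eq_C_mul, map_smul, smul_eq_mul]
  refine eventually_neg_of_iteratedDeriv (N := 2 * m)
    (ContDiffAt.sum fun a _ => ContDiffAt.sum fun b _ => contDiffAt_const.mul (hsm _))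
    (fun k hk => ?_) ?_
  · rw [hder k hk.le, if_neg hk.ne]
  · rw [hder _ le_rfl, if_pos rfl, hL.map_det_sq, hL1, mul_one]
    exact mul_neg_of_pos_of_neg (by positivity) hs

end SymmetricDet

namespace CompleteGraph

open Finset Matrix SimpleGraph

variable {n : ℕ}

/-- `φ` assigns a parent to every nonroot vertex so that all vertices descend from the root `0`. -/
def IsParentMap (φ : Fin n → Fin (n + 1)) : Prop :=
  ∃ h : Fin (n + 1) → ℕ, ∀ i, h (φ i) < h i.succ

/-- The reduced Laplacian of the digraph with the edges `i ⟶ φ i`. -/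
def parentLaplacian (φ : Fin n → Fin (n + 1)) : Matrix (Fin n) (Fin n) ℝ :=
  Matrix.of fun i j => (if i = j then 1 else 0) - (if φ i = j.succ then 1 else 0)

theorem IsParentMap.ne {φ : Fin n → Fin (n + 1)} (hφ : IsParentMap φ) (i : Fin n) :
    i.succ ≠ φ i := by
  obtain ⟨h, hh⟩ := hφ
  intro hi
  exact (hh i).ne (congrArg h hi.symm)

theorem IsParentMap.det_parentLaplacian {φ : Fin n → Fin (n + 1)} (hφ : IsParentMap φ) :
    (parentLaplacian φ).det = 1 := by
  have hne := hφ.ne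
  obtain ⟨h, hh⟩ := hφ
  rw [det_apply', sum_eq_single 1]
  · refine Eq.trans (b := ∏ i : Fin n, (1 : ℝ)) ?_ (by simp)
    simp [parentLaplacian, (hne _).symm]
  · intro σ _ hσ
    obtain ⟨i, hi⟩ : ∃ i, σ i ≠ i := by
      by_contra! hcon
      exact hσ (Equiv.ext hcon)
    by_contra hprod
    have hk (k : Fin n) (hk : σ k ≠ k) : φ (σ k) = k.succ := by
      by_contra hcon
      refine hprod (mul_eq_zero_of_right _ (prod_eq_zero (mem_univ k) ?_))
      simp [parentLaplacian, hk, hcon]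
    refine (sum_lt_sum (s := univ) (f := fun k => h k.succ) (g := fun k => h (σ k).succ)
      (fun k _ => ?_) ⟨i, mem_univ i, ?_⟩).ne (Equiv.sum_comp σ fun k => h k.succ).symm
    · by_cases hkk : σ k = k
      · rw [hkk]
      · exact ((hk k hkk) ▸ hh (σ k)).le
    · exact (hk i hi) ▸ hh (σ i)
  · simp

theorem det_parentLaplacian_of_not {φ : Fin n → Fin (n + 1)} (hφ : ¬ IsParentMap φ) :
    (parentLaplacian φ).det = 0 := by
  classical
  set Φ : Fin (n + 1) → Fin (n + 1) := Fin.cons 0 φ with hΦ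
  have hΦs (i : Fin n) : Φ i.succ = φ i := by simp [hΦ]
  let P : Fin (n + 1) → Prop := fun v => ∃ k, Φ^[k] v = 0
  have hP0 : P 0 := ⟨0, rfl⟩
  have hP (i : Fin n) : P (φ i) ↔ P i.succ := by
    rw [← hΦs]
    constructor
    · rintro ⟨k, hk⟩
      exact ⟨k + 1, by rwa [Function.iterate_succ_apply]⟩
    · rintro ⟨_ | k, hk⟩
      · exact absurd hk (Fin.succ_ne_zero i)
      · exact ⟨k, by rwa [Function.iterate_succ_apply] at hk⟩
  obtain ⟨i₀, hi₀⟩ : ∃ i : Fin n, ¬ P i.succ := by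
    by_contra! hcon
    have hall (v : Fin (n + 1)) : P v := by
      induction v using Fin.cases with
      | zero => exact hP0
      | succ i => exact hcon i
    refine hφ ⟨fun v => Nat.find (hall v), fun i => ?_⟩
    have hspec := Nat.find_spec (hall i.succ)
    obtain hz | ⟨k, hk⟩ : Nat.find (hall i.succ) = 0 ∨ ∃ k, Nat.find (hall i.succ) = k + 1 := by
      cases Nat.find (hall i.succ) <;> simp
    · rw [hz] at hspec
      exact absurd hspec (Fin.succ_ne_zero i)
    · rw [hk, Function.iterate_succ_apply, hΦs] at hspec
      exact (Nat.find_min' (hall (φ i)) hspec).trans_lt (by simp [hk])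
  refine exists_mulVec_eq_zero_iff.mp ⟨fun i => if P i.succ then 0 else 1, fun h => ?_, ?_⟩
  · simpa [hi₀] using congrFun h i₀
  · ext i
    simp only [mulVec, dotProduct, parentLaplacian, of_apply, sub_mul, sum_sub_distrib, ite_mul,
      one_mul, zero_mul, sum_ite_eq, mem_univ, if_true, Pi.zero_apply]
    have h0 := hP i
    obtain h | ⟨j, hj⟩ := Fin.eq_zero_or_eq_succ (φ i)
    · rw [h] at h0 ⊢
      rw [if_pos (h0.mp hP0)]
      simp [(Fin.succ_ne_zero _).symm]
    · rw [hj] at h0 ⊢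
      simp [h0]

/-- The weight of the pair of vertices `i, j`, with weight zero on the diagonal. -/
noncomputable def edgeWeight (x : (⊤ : SimpleGraph (Fin n)).edgeSet → ℝ) (i j : Fin n) : ℝ :=
  if h : i ≠ j then x ⟨s(i, j), h⟩ else 0

/-- The Laplacian of the complete graph with edge weights `x`, reduced at the vertex `0`. -/
noncomputable def reducedLaplacian (x : (⊤ : SimpleGraph (Fin (n + 1))).edgeSet → ℝ) :
    Matrix (Fin n) (Fin n) ℝ :=
  Matrix.of fun i j => (if i = j then ∑ k, edgeWeight x i.succ k else 0) -
    edgeWeight x i.succ j.succ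

theorem det_reducedLaplacian_eq_sum [DecidablePred (IsParentMap (n := n))]
    (x : (⊤ : SimpleGraph (Fin (n + 1))).edgeSet → ℝ) :
    (reducedLaplacian x).det =
      ∑ φ : Fin n → Fin (n + 1) with IsParentMap φ, ∏ i, edgeWeight x i.succ (φ i) := by
  have hrow : (reducedLaplacian x).det = detRowAlternating (R := ℝ) fun i : Fin n =>
      ∑ k : Fin (n + 1), edgeWeight x i.succ k •
        (fun j : Fin n => (if i = j then (1 : ℝ) else 0) - (if k = j.succ then 1 else 0)) := by
    change detRowAlternating (R := ℝ) (reducedLaplacian x) = _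
    congr 1
    ext i j
    simp [reducedLaplacian, mul_sub, Finset.sum_apply]
  rw [hrow, ← AlternatingMap.coe_multilinearMap, MultilinearMap.map_sum, sum_filter]
  refine sum_congr rfl fun φ _ => ?_
  rw [MultilinearMap.map_smul_univ]
  change _ • (parentLaplacian φ).det = _
  split_ifs with h
  · simp [h.det_parentLaplacian]
  · simp [det_parentLaplacian_of_not h]

/-- The edge from a nonroot vertex to its parent. -/
def IsParentMap.edge {φ : Fin n → Fin (n + 1)} (hφ : IsParentMap φ) (i : Fin n) :
    (⊤ : SimpleGraph (Fin (n + 1))).edgeSet :=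
  ⟨s(i.succ, φ i), hφ.ne i⟩

open scoped Classical in
/-- The set of edges from nonroot vertices to their parents. -/
noncomputable def parentEdges (φ : Fin n → Fin (n + 1)) :
    Finset (⊤ : SimpleGraph (Fin (n + 1))).edgeSet :=
  univ.filter fun e => ∃ i : Fin n, e.1 = s(i.succ, φ i)

theorem mem_parentEdges {φ : Fin n → Fin (n + 1)}
    {e : (⊤ : SimpleGraph (Fin (n + 1))).edgeSet} :
    e ∈ parentEdges φ ↔ ∃ i : Fin n, e.1 = s(i.succ, φ i) := by
  simp [parentEdges]

theorem IsParentMap.parentEdges_eq {φ : Fin n → Fin (n + 1)} (hφ : IsParentMap φ)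
    [DecidableEq (⊤ : SimpleGraph (Fin (n + 1))).edgeSet] :
    parentEdges φ = univ.image hφ.edge := by
  ext e
  simp [mem_parentEdges, IsParentMap.edge, Subtype.ext_iff, eq_comm]

theorem card_edgeSet_fromEdgeSet (t : Finset (⊤ : SimpleGraph (Fin (n + 1))).edgeSet) :
    Nat.card (fromEdgeSet (Subtype.val '' (t : Set (⊤ : SimpleGraph (Fin (n + 1))).edgeSet))).edgeSet
      = #t := by
  have h : (fromEdgeSet (Subtype.val ''
      (t : Set (⊤ : SimpleGraph (Fin (n + 1))).edgeSet))).edgeSet =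
      Subtype.val '' (t : Set (⊤ : SimpleGraph (Fin (n + 1))).edgeSet) := by
    rw [edgeSet_fromEdgeSet, sdiff_eq_left, Set.disjoint_left]
    rintro _ ⟨e, _, rfl⟩ he
    exact not_isDiag_of_mem_edgeSet _ e.2 he
  rw [h, Nat.card_image_of_injective Subtype.val_injective]
  simp

theorem isSpanningTree_iff (t : Finset (⊤ : SimpleGraph (Fin (n + 1))).edgeSet) :
    IsSpanningTree (⊤ : SimpleGraph (Fin (n + 1))) ↑t ↔
      (fromEdgeSet (Subtype.val '' (t : Set (⊤ : SimpleGraph (Fin (n + 1))).edgeSet))).Connected ∧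
        #t = n := by
  rw [IsSpanningTree, ← isTree_iff, isTree_iff_connected_and_card, card_edgeSet_fromEdgeSet]
  simp

theorem IsParentMap.connected {φ : Fin n → Fin (n + 1)} (hφ : IsParentMap φ) :
    (fromEdgeSet (Subtype.val '' (parentEdges φ : Set (⊤ : SimpleGraph (Fin (n + 1))).edgeSet))
      ).Connected := by
  have hne := hφ.ne
  have hadj (i : Fin n) : (fromEdgeSet (Subtype.val ''
      (parentEdges φ : Set (⊤ : SimpleGraph (Fin (n + 1))).edgeSet))).Adj i.succ (φ i) := by
    rw [fromEdgeSet_adj]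
    exact ⟨⟨hφ.edge i, by simpa [mem_parentEdges] using ⟨i, rfl⟩, rfl⟩, hne i⟩
  obtain ⟨h, hh⟩ := hφ
  rw [connected_iff_exists_forall_reachable]
  refine ⟨0, fun v => ?_⟩
  induction hv : h v using Nat.strong_induction_on generalizing v with
  | _ N ih =>
    induction v using Fin.cases with
    | zero => rfl
    | succ i => exact (ih _ (hv ▸ hh i) _ rfl).trans (hadj i).symm.reachable

theorem IsParentMap.card_parentEdges {φ : Fin n → Fin (n + 1)} (hφ : IsParentMap φ) :
    #(parentEdges φ) = n := by
  classical
  refine le_antisymm ?_ ?_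
  · rw [hφ.parentEdges_eq]
    exact card_image_le.trans (by simp)
  · have := hφ.connected.card_vert_le_card_edgeSet_add_one
    rw [card_edgeSet_fromEdgeSet] at this
    simpa using this

theorem IsParentMap.edge_injective {φ : Fin n → Fin (n + 1)} (hφ : IsParentMap φ) :
    Function.Injective hφ.edge := by
  classical
  have h : #(univ.image hφ.edge) = #(univ : Finset (Fin n)) := by
    rw [← hφ.parentEdges_eq, hφ.card_parentEdges, card_univ, Fintype.card_fin]
  simpa using card_image_iff.mp h

theorem IsParentMap.eq_of_parentEdges_eq {φ ψ : Fin n → Fin (n + 1)} (hφ : IsParentMap φ)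
    (h : parentEdges φ = parentEdges ψ) : φ = ψ := by
  have hmem (i : Fin n) := mem_parentEdges.mp (h ▸ mem_parentEdges.mpr ⟨i, rfl⟩ :
    hφ.edge i ∈ parentEdges ψ)
  obtain ⟨r, hr⟩ := hφ
  funext i
  induction hi : r i.succ using Nat.strong_induction_on generalizing i with
  | _ N ih =>
    obtain ⟨j, hj⟩ := hmem i
    have hj : s(i.succ, φ i) = s(j.succ, ψ j) := hj
    rw [Sym2.eq_iff] at hj
    obtain ⟨h1, h2⟩ | ⟨h1, h2⟩ := hj
    · rw [Fin.succ_inj.mp h1] at h2 ⊢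
      exact h2
    · have hlt : r j.succ < r i.succ := h2 ▸ hr i
      have hj' : φ j = ψ j := ih _ (hi ▸ hlt) j rfl
      have := hr j
      rw [hj', ← h1] at this
      omega

theorem exists_isParentMap {t : Finset (⊤ : SimpleGraph (Fin (n + 1))).edgeSet}
    (ht : IsSpanningTree (⊤ : SimpleGraph (Fin (n + 1))) ↑t) :
    ∃ φ : Fin n → Fin (n + 1), IsParentMap φ ∧ parentEdges φ = t := by
  obtain ⟨hc, hcard⟩ := (isSpanningTree_iff t).mp ht
  set G := fromEdgeSet (Subtype.val '' (t : Set (⊤ : SimpleGraph (Fin (n + 1))).edgeSet)) with hG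
  have hstep (i : Fin n) : ∃ v, G.Adj i.succ v ∧ G.dist v 0 < G.dist i.succ 0 := by
    obtain ⟨w, hw⟩ := hc.exists_walk_length_eq_dist i.succ 0
    cases w with
    | @cons _ v _ hadj q =>
      exact ⟨v, hadj, by rw [← hw, Walk.length_cons]; exact Nat.lt_succ_of_le (dist_le q)⟩
  choose φ hadj hdist using hstep
  have hφ : IsParentMap φ := ⟨fun v => G.dist v 0, hdist⟩
  refine ⟨φ, hφ, eq_of_subset_of_card_le (fun e he => ?_) ?_⟩
  · obtain ⟨i, hi⟩ := mem_parentEdges.mp he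
    obtain ⟨⟨e', he', hee⟩, _⟩ := (fromEdgeSet_adj _).mp (hadj i)
    rw [← hi] at hee
    exact Subtype.ext hee ▸ he'
  · rw [hcard, hφ.card_parentEdges]

theorem prod_parentEdges {φ : Fin n → Fin (n + 1)} (hφ : IsParentMap φ)
    (x : (⊤ : SimpleGraph (Fin (n + 1))).edgeSet → ℝ) :
    ∏ e ∈ parentEdges φ, x e = ∏ i, edgeWeight x i.succ (φ i) := by
  classical
  rw [hφ.parentEdges_eq, prod_image hφ.edge_injective.injOn]
  refine prod_congr rfl fun i _ => ?_
  rw [edgeWeight, dif_pos (hφ.ne i)]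
  rfl

theorem spanningTreePoly_eq_det
    [Fintype (⊤ : SimpleGraph (Fin (n + 1))).edgeSet]
    (x : (⊤ : SimpleGraph (Fin (n + 1))).edgeSet → ℝ) :
    spanningTreePoly (⊤ : SimpleGraph (Fin (n + 1))) x = (reducedLaplacian x).det := by
  classical
  rw [det_reducedLaplacian_eq_sum, spanningTreePoly]
  symm
  refine sum_bij (fun φ _ => parentEdges φ) (fun φ hφ => ?_) (fun φ hφ ψ _ h => ?_)
    (fun t ht => ?_) fun φ hφ => ?_
  · have hφ := (mem_filter.mp hφ).2
    exact mem_filter.mpr ⟨mem_univ _, (isSpanningTree_iff _).mpr ⟨hφ.connected,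
      hφ.card_parentEdges⟩⟩
  · exact (mem_filter.mp hφ).2.eq_of_parentEdges_eq h
  · obtain ⟨φ, hφ, h⟩ := exists_isParentMap (mem_filter.mp ht).2
    exact ⟨φ, mem_filter.mpr ⟨mem_univ _, hφ⟩, h⟩
  · exact (prod_parentEdges (mem_filter.mp hφ).2 x).symm

theorem edgeWeight_comm (x : (⊤ : SimpleGraph (Fin n)).edgeSet → ℝ) (i j : Fin n) :
    edgeWeight x i j = edgeWeight x j i := by
  by_cases h : i = j
  · rw [h]
  · have he : (⟨s(i, j), h⟩ : (⊤ : SimpleGraph (Fin n)).edgeSet) = ⟨s(j, i), Ne.symm h⟩ :=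
      Subtype.ext Sym2.eq_swap
    simp only [edgeWeight, dif_pos h, dif_pos (Ne.symm h), he]

theorem edgeWeight_nonneg {x : (⊤ : SimpleGraph (Fin n)).edgeSet → ℝ} (hx : x ∈ posOrthant _)
    (i j : Fin n) : 0 ≤ edgeWeight x i j := by
  rw [edgeWeight]
  split_ifs
  exacts [(hx _).le, le_rfl]

theorem edgeWeight_pos {x : (⊤ : SimpleGraph (Fin n)).edgeSet → ℝ} (hx : x ∈ posOrthant _)
    {i j : Fin n} (h : i ≠ j) : 0 < edgeWeight x i j := by
  rw [edgeWeight, dif_pos h]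
  exact hx _

theorem edgeWeight_add (x y : (⊤ : SimpleGraph (Fin n)).edgeSet → ℝ) (i j : Fin n) :
    edgeWeight (x + y) i j = edgeWeight x i j + edgeWeight y i j := by
  unfold edgeWeight
  split_ifs <;> simp

theorem edgeWeight_smul (t : ℝ) (x : (⊤ : SimpleGraph (Fin n)).edgeSet → ℝ) (i j : Fin n) :
    edgeWeight (t • x) i j = t * edgeWeight x i j := by
  unfold edgeWeight
  split_ifs <;> simp

theorem reducedLaplacian_add (x y : (⊤ : SimpleGraph (Fin (n + 1))).edgeSet → ℝ) :
    reducedLaplacian (x + y) = reducedLaplacian x + reducedLaplacian y := by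
  ext i j
  simp only [reducedLaplacian, edgeWeight_add, sum_add_distrib, of_apply, Matrix.add_apply]
  split_ifs <;> ring

theorem reducedLaplacian_smul (t : ℝ) (x : (⊤ : SimpleGraph (Fin (n + 1))).edgeSet → ℝ) :
    reducedLaplacian (t • x) = t • reducedLaplacian x := by
  ext i j
  simp only [reducedLaplacian, edgeWeight_smul, ← mul_sum, of_apply, Matrix.smul_apply,
    smul_eq_mul]
  split_ifs <;> ring

theorem dotProduct_reducedLaplacian_mulVec (x : (⊤ : SimpleGraph (Fin (n + 1))).edgeSet → ℝ)
    {v : Fin (n + 1) → ℝ} (hv : v 0 = 0) :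
    (fun i : Fin n => v i.succ) ⬝ᵥ (reducedLaplacian x *ᵥ fun i : Fin n => v i.succ) =
      (∑ i, ∑ j, edgeWeight x i j * (v i - v j) ^ 2) / 2 := by
  have h1 : ∑ i, ∑ j, edgeWeight x i j * v j ^ 2 = ∑ i, ∑ j, edgeWeight x i j * v i ^ 2 := by
    rw [sum_comm]
    exact sum_congr rfl fun i _ => sum_congr rfl fun j _ => by rw [edgeWeight_comm]
  have h2 : ∑ i, ∑ j, edgeWeight x i j * (v i - v j) ^ 2 =
      2 * ∑ i, ∑ j, edgeWeight x i j * v i ^ 2 - 2 * ∑ i, ∑ j, edgeWeight x i j * v i * v j := by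
    rw [two_mul]
    nth_rw 1 [← h1]
    simp only [mul_sum, ← sum_add_distrib, ← sum_sub_distrib]
    exact sum_congr rfl fun i _ => sum_congr rfl fun j _ => by ring
  rw [h2, ← mul_sub, mul_div_cancel_left₀ _ two_ne_zero, Fin.sum_univ_succ,
    Fin.sum_univ_succ (fun i => ∑ j, edgeWeight x i j * v i * v j)]
  simp only [hv, mul_zero, zero_mul, ne_eq, OfNat.ofNat_ne_zero, not_false_eq_true, zero_pow,
    sum_const_zero, zero_add, dotProduct, mulVec, reducedLaplacian, of_apply, sub_mul,
    ite_mul, sum_sub_distrib, sum_ite_eq, mem_univ, if_true]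
  rw [← sum_sub_distrib]
  refine sum_congr rfl fun i _ => ?_
  rw [Fin.sum_univ_succ (fun j => edgeWeight x i.succ j * v i.succ * v j), hv, mul_sub, mul_sum,
    ← sum_mul]
  simp only [mul_zero, zero_add]
  congr 1
  · ring
  · exact sum_congr rfl fun j _ => by ring

theorem posDef_reducedLaplacian {x : (⊤ : SimpleGraph (Fin (n + 1))).edgeSet → ℝ}
    (hx : x ∈ posOrthant _) : (reducedLaplacian x).PosDef := by
  rw [posDef_iff_dotProduct_mulVec]
  constructor
  · ext i j
    simp only [conjTranspose_apply, star_trivial, reducedLaplacian, of_apply]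
    rw [edgeWeight_comm x j.succ i.succ]
    by_cases h : i = j
    · rw [h]
    · rw [if_neg h, if_neg (Ne.symm h)]
  · intro v hv
    obtain ⟨i, hi⟩ := Function.ne_iff.mp hv
    have h := dotProduct_reducedLaplacian_mulVec x (v := Fin.cons 0 v) (Fin.cons_zero _ _)
    simp only [Fin.cons_succ] at h
    rw [star_trivial, h]
    have hnn (i j : Fin (n + 1)) : 0 ≤ edgeWeight x i j *
        ((Fin.cons 0 v : Fin (n + 1) → ℝ) i - (Fin.cons 0 v : Fin (n + 1) → ℝ) j) ^ 2 :=
      mul_nonneg (edgeWeight_nonneg hx i j) (sq_nonneg _)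
    refine half_pos (sum_pos' (fun i _ => sum_nonneg fun j _ => hnn i j)
      ⟨i.succ, mem_univ _, sum_pos' (fun j _ => hnn _ j) ⟨0, mem_univ _, ?_⟩⟩)
    have := edgeWeight_pos hx (Fin.succ_ne_zero i)
    simp only [Fin.cons_succ, Fin.cons_zero, sub_zero]
    have hi : v i ≠ 0 := hi
    positivity

open scoped MatrixOrder Matrix.Norms.L2Operator in
theorem _root_.Matrix.PosDef.exists_eq_mul_transpose {A : Matrix (Fin n) (Fin n) ℝ}
    (hA : A.PosDef) : ∃ P : Matrix (Fin n) (Fin n) ℝ, A = P * Pᵀ ∧ P.det ≠ 0 := by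
  obtain ⟨B, hB⟩ := CStarAlgebra.nonneg_iff_eq_star_mul_self.mp hA.posSemidef.nonneg
  rw [star_eq_conjTranspose, conjTranspose_eq_transpose_of_trivial] at hB
  refine ⟨Bᵀ, by simpa using hB, fun h => ?_⟩
  have := hA.det_pos
  rw [hB, det_mul, h, zero_mul] at this
  exact this.false

/-- The matrix extending a vector on the nonroot vertices to one on all vertices of sum zero. -/
def rootExtension (n : ℕ) : Matrix (Fin (n + 1)) (Fin n) ℝ :=
  Matrix.of (Fin.cons (fun _ => -1) fun i j => if i = j then 1 else 0)

theorem rootExtension_succ (i j : Fin n) :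
    rootExtension n i.succ j = if i = j then 1 else 0 := rfl

theorem sum_rootExtension (j : Fin n) : ∑ v, rootExtension n v j = 0 := by
  rw [Fin.sum_univ_succ]
  simp [rootExtension]

/-- The edge weights whose reduced Laplacian is the symmetric part of a given matrix. -/
noncomputable def laplacianWeights :
    Matrix (Fin n) (Fin n) ℝ →ₗ[ℝ] ((⊤ : SimpleGraph (Fin (n + 1))).edgeSet → ℝ) where
  toFun M e := Sym2.lift ⟨fun u v => -((rootExtension n * M * (rootExtension n)ᵀ) u v +
    (rootExtension n * M * (rootExtension n)ᵀ) v u) / 2, fun u v => by ring⟩ e.1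
  map_add' M N := by
    ext ⟨e, he⟩
    induction e with
    | _ u v => simp [Matrix.mul_add, Matrix.add_mul]; ring
  map_smul' t M := by
    ext ⟨e, he⟩
    induction e with
    | _ u v => simp; ring

theorem reducedLaplacian_laplacianWeights {M : Matrix (Fin n) (Fin n) ℝ} (hM : M.IsSymm) :
    reducedLaplacian (laplacianWeights M) = M := by
  set N := rootExtension n * M * (rootExtension n)ᵀ with hN
  have hNs (u v : Fin (n + 1)) : N u v = N v u := by
    have : Nᵀ = N := by
      rw [hN, transpose_mul, transpose_mul, transpose_transpose, hM.eq, Matrix.mul_assoc]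
    rw [← this, transpose_apply, this]
  have hw (u v : Fin (n + 1)) : edgeWeight (laplacianWeights M) u v =
      (if u = v then N u u else 0) - N u v := by
    by_cases h : u = v
    · simp [edgeWeight, h]
    · rw [edgeWeight, dif_pos h, if_neg h]
      change -(N u v + N v u) / 2 = _
      rw [hNs v u]
      ring
  have hsum (u : Fin (n + 1)) : ∑ v, N u v = 0 := by
    simp only [hN, Matrix.mul_apply (N := (rootExtension n)ᵀ), transpose_apply]
    rw [sum_comm]
    simp only [← mul_sum, sum_rootExtension, mul_zero, sum_const_zero]
  have hNM (i j : Fin n) : N i.succ j.succ = M i j := by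
    simp [hN, Matrix.mul_apply, rootExtension_succ]
  ext i j
  simp only [reducedLaplacian, of_apply, hw, sum_sub_distrib, hsum, hNM, Fin.succ_inj]
  simp

end CompleteGraph

namespace CompleteGraph

open Finset Matrix SimpleGraph Filter Topology SymmetricDet

variable {n : ℕ}

theorem det_mul_transpose_add {m : ℕ} (P : Matrix (Fin n) (Fin n) ℝ)
    {J : Matrix (Fin n) (Fin m) ℝ} (hJ : Jᵀ * J = 1) (S : Matrix (Fin m) (Fin m) ℝ) :
    (P * Pᵀ + P * J * S * (P * J)ᵀ).det = P.det ^ 2 * (1 + S).det := by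
  have h : P * Pᵀ + P * J * S * (P * J)ᵀ = P * (1 + J * (S * Jᵀ)) * Pᵀ := by
    simp only [transpose_mul, Matrix.mul_add, Matrix.add_mul, Matrix.mul_one, Matrix.mul_assoc]
  rw [h, det_mul, det_mul, det_transpose, det_one_add_mul_comm, Matrix.mul_assoc, hJ,
    Matrix.mul_one]
  ring

/-- Near a point of the positive orthant, the spanning-tree polynomial of the complete graph
restricts to a positive multiple of `shiftedDet` on a linear image of the matrix space. -/
theorem exists_spanningTreePoly_add_eq [Fintype (⊤ : SimpleGraph (Fin (n + 1))).edgeSet]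
    {m : ℕ} (hm : m ≤ n) {x : (⊤ : SimpleGraph (Fin (n + 1))).edgeSet → ℝ}
    (hx : x ∈ posOrthant _) :
    ∃ (d : ℝ) (l : (Fin m × Fin m → ℝ) →ₗ[ℝ] ((⊤ : SimpleGraph (Fin (n + 1))).edgeSet → ℝ)),
      0 < d ∧ ∀ Z, spanningTreePoly (⊤ : SimpleGraph (Fin (n + 1))) (x + l Z) =
        d * shiftedDet Z := by
  obtain ⟨P, hP, hdet⟩ := (posDef_reducedLaplacian hx).exists_eq_mul_transpose
  let J : Matrix (Fin n) (Fin m) ℝ := Matrix.of fun i j => if i = Fin.castLE hm j then 1 else 0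
  have hJ : Jᵀ * J = 1 := by
    ext i j
    simp [J, Matrix.mul_apply, Matrix.one_apply, eq_comm]
  let S : (Fin m × Fin m → ℝ) →ₗ[ℝ] Matrix (Fin n) (Fin n) ℝ :=
    { toFun := fun Z => P * J * (Matrix.of fun i j => symmPart Z (i, j)) * (P * J)ᵀ
      map_add' := fun Z W => by
        rw [← Matrix.add_mul, ← Matrix.mul_add, map_add]
        rfl
      map_smul' := fun t Z => by
        rw [RingHom.id_apply, ← Matrix.smul_mul, ← Matrix.mul_smul, map_smul]
        rfl }
  have hS (Z : Fin m × Fin m → ℝ) : (S Z).IsSymm := by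
    have h : (Matrix.of fun i j => symmPart Z (i, j))ᵀ = Matrix.of fun i j => symmPart Z (i, j) := by
      ext i j
      simp [symmPart_apply, add_comm]
    change (P * J * (Matrix.of fun i j => symmPart Z (i, j)) * (P * J)ᵀ)ᵀ = _
    rw [transpose_mul _ (P * J)ᵀ, transpose_transpose, transpose_mul (P * J), h,
      ← Matrix.mul_assoc]
    rfl
  refine ⟨P.det ^ 2, laplacianWeights ∘ₗ S, by positivity, fun Z => ?_⟩
  rw [spanningTreePoly_eq_det, reducedLaplacian_add, LinearMap.comp_apply,
    reducedLaplacian_laplacianWeights (hS Z), hP]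
  refine (det_mul_transpose_add P hJ _).trans ?_
  congr 2

theorem spanningTreePoly_pos [Fintype (⊤ : SimpleGraph (Fin (n + 1))).edgeSet]
    {x : (⊤ : SimpleGraph (Fin (n + 1))).edgeSet → ℝ} (hx : x ∈ posOrthant _) :
    0 < spanningTreePoly (⊤ : SimpleGraph (Fin (n + 1))) x := by
  rw [spanningTreePoly_eq_det]
  exact (posDef_reducedLaplacian hx).det_pos

theorem spanningTreePoly_smul [Fintype (⊤ : SimpleGraph (Fin (n + 1))).edgeSet] (t : ℝ)
    (x : (⊤ : SimpleGraph (Fin (n + 1))).edgeSet → ℝ) :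
    spanningTreePoly (⊤ : SimpleGraph (Fin (n + 1))) (t • x) =
      t ^ n * spanningTreePoly (⊤ : SimpleGraph (Fin (n + 1))) x := by
  rw [spanningTreePoly_eq_det, spanningTreePoly_eq_det, reducedLaplacian_smul, det_smul,
    Fintype.card_fin]

section Cone

variable [Fintype (⊤ : SimpleGraph (Fin (n + 1))).edgeSet]
  {C : Set ((⊤ : SimpleGraph (Fin (n + 1))).edgeSet → ℝ)}

theorem not_completelyMonotoneOn_of_pos_exponent (hn : n ≠ 0) {s : ℝ} (hs : 0 < s)
    (hsub : C ⊆ posOrthant _) (hne : C.Nonempty) (hopen : IsOpen C) (hconv : Convex ℝ C)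
    (hcone : ∀ x ∈ C, ∀ t : ℝ, 0 < t → t • x ∈ C) :
    ¬ CompletelyMonotoneOn
      (fun x => spanningTreePoly (⊤ : SimpleGraph (Fin (n + 1))) x ^ s) C := by
  intro hf
  obtain ⟨x, hx⟩ := hne
  have hpos := spanningTreePoly_pos (hsub hx)
  set α : ℝ := n * s
  have hα : 0 < α := mul_pos (by positivity) hs
  have hhom {t : ℝ} (ht : 0 < t) : spanningTreePoly (⊤ : SimpleGraph (Fin (n + 1))) (t • x) ^ s =
      t ^ α * spanningTreePoly (⊤ : SimpleGraph (Fin (n + 1))) x ^ s := by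
    rw [spanningTreePoly_smul, Real.mul_rpow (by positivity) hpos.le, ← Real.rpow_natCast,
      ← Real.rpow_mul ht.le]
  have h := hf.sum_mul_apply_add_nonneg hopen hconv hcone (x := ![x, (2 : ℝ) • x])
    (fun a => by fin_cases a; exacts [hx, hcone x hx 2 two_pos]) ![3 ^ α, -2 ^ α]
  simp only [Fin.sum_univ_two, cons_val_zero, cons_val_one] at h
  rw [show x + x = (2 : ℝ) • x by module, show x + (2 : ℝ) • x = (3 : ℝ) • x by module,
    show (2 : ℝ) • x + x = (3 : ℝ) • x by module,
    show (2 : ℝ) • x + (2 : ℝ) • x = (4 : ℝ) • x by module,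
    hhom two_pos, hhom three_pos, hhom four_pos] at h
  have hP := Real.rpow_pos_of_pos hpos s
  have h4 : (4 : ℝ) ^ α = 2 ^ α * 2 ^ α := by
    rw [← Real.mul_rpow two_pos.le two_pos.le]; norm_num
  have h89 : ((2 : ℝ) ^ α * 2 ^ α) * 2 ^ α < 3 ^ α * 3 ^ α := by
    rw [← Real.mul_rpow two_pos.le two_pos.le, ← Real.mul_rpow (by norm_num) two_pos.le,
      ← Real.mul_rpow three_pos.le three_pos.le]
    exact Real.rpow_lt_rpow (by norm_num) (by norm_num) hα
  have h2 := Real.rpow_pos_of_pos two_pos α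
  rw [h4] at h
  have : 0 < 2 ^ α * spanningTreePoly (⊤ : SimpleGraph (Fin (n + 1))) x ^ s *
      (3 ^ α * 3 ^ α - 2 ^ α * 2 ^ α * 2 ^ α) := by
    refine mul_pos (by positivity) (by linarith)
  linarith

theorem not_completelyMonotoneOn_of_prod_neg {m : ℕ} (hm : m ≤ n) {s : ℝ}
    (hs : ∏ k ∈ range m, ((s + k / 2) * (s - 1 + k / 2)) < 0)
    (hsub : C ⊆ posOrthant _) (hne : C.Nonempty) (hopen : IsOpen C) (hconv : Convex ℝ C)
    (hcone : ∀ x ∈ C, ∀ t : ℝ, 0 < t → t • x ∈ C) :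
    ¬ CompletelyMonotoneOn
      (fun x => spanningTreePoly (⊤ : SimpleGraph (Fin (n + 1))) x ^ s) C := by
  intro hf
  obtain ⟨x, hx⟩ := hne
  obtain ⟨d, l, hd, hl⟩ := exists_spanningTreePoly_add_eq hm (hsub hx)
  have hnear : ∀ᶠ t in 𝓝[>] (0 : ℝ), ∀ a : Equiv.Perm (Fin m) × Finset (Fin m),
      (1 / 2 : ℝ) • x + t • l (partialPerm a) ∈ C := by
    refine eventually_all.mpr fun a => nhdsWithin_le_nhds ?_
    have hc : Continuous fun t : ℝ => (1 / 2 : ℝ) • x + t • l (partialPerm a) := by fun_prop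
    refine hc.continuousAt.eventually_mem (hopen.mem_nhds ?_)
    simpa using hcone x hx (1 / 2) (by norm_num)
  obtain ⟨t, ht, hneg⟩ := (hnear.and (eventually_sum_shiftedDet_rpow_neg hs)).exists
  have hadd (a b : Equiv.Perm (Fin m) × Finset (Fin m)) :
      (1 / 2 : ℝ) • x + t • l (partialPerm a) + ((1 / 2 : ℝ) • x + t • l (partialPerm b)) =
        x + l (t • (partialPerm a + partialPerm b)) := by
    rw [map_smul, map_add]
    module
  have hpow (a b : Equiv.Perm (Fin m) × Finset (Fin m)) :
      spanningTreePoly (⊤ : SimpleGraph (Fin (n + 1)))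
        ((1 / 2 : ℝ) • x + t • l (partialPerm a) + ((1 / 2 : ℝ) • x + t • l (partialPerm b))) ^ s =
      d ^ s * shiftedDet (t • (partialPerm a + partialPerm b)) ^ s := by
    have hp : 0 < spanningTreePoly (⊤ : SimpleGraph (Fin (n + 1)))
        ((1 / 2 : ℝ) • x + t • l (partialPerm a) + ((1 / 2 : ℝ) • x + t • l (partialPerm b))) :=
      spanningTreePoly_pos fun e => add_pos (hsub (ht a) e) (hsub (ht b) e)
    rw [hadd, hl] at hp ⊢
    exact Real.mul_rpow hd.le (pos_of_mul_pos_right hp hd.le).le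
  have h := hf.sum_mul_apply_add_nonneg hopen hconv hcone ht permSign
  simp only [hpow] at h
  refine h.not_gt (lt_of_eq_of_lt ?_ (mul_neg_of_pos_of_neg (Real.rpow_pos_of_pos hd s) hneg))
  simp only [mul_sum]
  exact sum_congr rfl fun a _ => sum_congr rfl fun b _ => by ring

end Cone

theorem exists_prod_neg {β : ℝ} (h0 : 0 ≤ β) (hβ : ∀ k : ℕ, β ≠ k / 2) (hn : β < (n - 1) / 2) :
    ∃ m ≤ n, ∏ k ∈ range m, ((-β + k / 2) * (-β - 1 + k / 2)) < 0 := by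
  set k := ⌈2 * β⌉₊ with hk
  have hle : 2 * β ≤ k := Nat.le_ceil _
  have hlt : (k : ℝ) < 2 * β + 1 := Nat.ceil_lt_add_one (by positivity)
  have hlt' : 2 * β < k := lt_of_le_of_ne hle fun h => hβ k (by linarith)
  have hkn : (k : ℝ) < n := by linarith
  refine ⟨k + 1, by exact_mod_cast hkn, ?_⟩
  rw [prod_range_succ]
  refine mul_neg_of_pos_of_neg (prod_pos fun j hj => ?_)
    (mul_neg_of_pos_of_neg (by linarith) (by linarith))
  have hj : (j : ℝ) + 1 ≤ k := by exact_mod_cast mem_range.mp hj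
  exact mul_pos_of_neg_of_neg (by linarith) (by linarith)

end CompleteGraph

end

/-- Let `K_p` (`p ≥ 2`) be the complete graph on `p` vertices, with
spanning-tree polynomial `T_{K_p}`.  If `β ∉ {0, 1/2, 1, 3/2, …} ∪ [(p−2)/2, ∞)`, then
`T_{K_p}^{-β}` is not completely monotone on any nonempty open convex subcone of the
positive orthant. -/
theorem inverse_power_spanning_tree_poly_complete_graph_not_completely_monotone
    (p : ℕ) (hp : 2 ≤ p) (β : ℝ)
    (hβ : ¬ ((∃ k : ℕ, β = (k : ℝ) / 2) ∨ ((p : ℝ) - 2) / 2 ≤ β))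
    (C' : Set ((⊤ : SimpleGraph (Fin p)).edgeSet → ℝ))
    (hsub : C' ⊆ posOrthant (⊤ : SimpleGraph (Fin p)).edgeSet)
    (hne : C'.Nonempty) (hopen : IsOpen C') (hconv : Convex ℝ C')
    (hcone : ∀ x ∈ C', ∀ t : ℝ, 0 < t → t • x ∈ C') :
    ¬ CompletelyMonotoneOn
        (fun x : (⊤ : SimpleGraph (Fin p)).edgeSet → ℝ =>
          spanningTreePoly (⊤ : SimpleGraph (Fin p)) x ^ (-β))
        C' := by
  obtain ⟨n, rfl⟩ : ∃ n, p = n + 1 := ⟨p - 1, by omega⟩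
  push Not at hβ
  obtain ⟨hhalf, hlt⟩ := hβ
  obtain h0 | h0 := lt_or_ge β 0
  · exact CompleteGraph.not_completelyMonotoneOn_of_pos_exponent (by omega) (neg_pos.mpr h0)
      hsub hne hopen hconv hcone
  · obtain ⟨m, hm, hs⟩ := CompleteGraph.exists_prod_neg (n := n) h0 hhalf
      (by push_cast at hlt; linarith)
    exact CompleteGraph.not_completelyMonotoneOn_of_prod_neg hm hs hsub hne hopen hconv hcone
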